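/- arXiv:2511.09897 — 2 statements merged into one kernel-verified Lean document; each statement's English description precedes it below -/
import Mathlib

section
/- Let π ∝ exp(−V) on ℝ^d (d ≥ 2) with V C² and α-strongly convex for some α > 0, satisfying the growth condition. Then any minimizer π⋆(dz) = p⋆(dz₁) q⋆(dz_{−1} ∣ z₁) of KL(· ‖ π) over C_star whose density is differentiable satisfies the self-consistency equations: p⋆(z₁) ∝ exp( − ∫₀^{z₁} ∫ ∂₁V(s, z_{−1}) q⋆(dz_{−1} ∣ s) ds ), and for each i ∈ {2, …, d}, q⋆_i(z_i ∣ z₁) ∝ exp( − ∫ V(z₁, z_i, z_{−{1,i}}) ∏_{j ≥ 2, j ≠ i} q⋆_j(dz_j ∣ z₁) ). -/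
open MeasureTheory ProbabilityTheory
open scoped ENNReal ProbabilityTheory

open Classical in
/-- Kullback–Leibler divergence: `∫ log (dμ/dπ) dμ` if `μ ≪ π` (and the integral is
well-defined), and `+∞` otherwise. -/
noncomputable def KL {E : Type*} [MeasurableSpace E] (μ π : Measure E) : ℝ≥0∞ :=
  if μ ≪ π ∧ Integrable (fun z => Real.log (μ.rnDeriv π z).toReal) μ then
    ENNReal.ofReal (∫ z, Real.log (μ.rnDeriv π z).toReal ∂μ)
  else ⊤

/-- The star-structured measure on `ℝ × ℝ^k` with root marginal `μ₁` and leaf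
conditional kernels `κ j`, i.e. `μ₁(dz₁) ∏_j κ_j(dz_j ∣ z₁)`. -/
noncomputable def starMeasure {k : ℕ} (μ₁ : Measure ℝ) (κ : Fin k → Kernel ℝ ℝ) :
    Measure (ℝ × (Fin k → ℝ)) :=
  μ₁.bind fun z₁ => (Measure.dirac z₁).prod (Measure.pi fun j => κ j z₁)

/-- `μ ∈ C_star`: the leaf coordinates are conditionally independent given the root. -/
def IsStar {k : ℕ} (μ : Measure (ℝ × (Fin k → ℝ))) : Prop :=
  IsProbabilityMeasure μ ∧
    ∃ (μ₁ : Measure ℝ) (κ : Fin k → Kernel ℝ ℝ),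
      IsProbabilityMeasure μ₁ ∧ (∀ j, IsMarkovKernel (κ j)) ∧ μ = starMeasure μ₁ κ

/-- `ν ∈ P(ℝ)^{⊗ k}`: product probability measures on `ℝ^k`. -/
def IsProductProb {k : ℕ} (ν : Measure (Fin k → ℝ)) : Prop :=
  ∃ m : Fin k → Measure ℝ, (∀ j, IsProbabilityMeasure (m j)) ∧ ν = Measure.pi m

/-- The probability measure with density proportional to `exp (-V)` (w.r.t. Lebesgue). -/
noncomputable def gibbs {E : Type*} [MeasureSpace E] (V : E → ℝ) : Measure E :=
  ((volume.withDensity fun z => ENNReal.ofReal (Real.exp (-V z))) Set.univ)⁻¹ •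
    (volume.withDensity fun z => ENNReal.ofReal (Real.exp (-V z)))

/-- The squared Euclidean norm on `ℝ × ℝ^k`. -/
def sqNorm {k : ℕ} (v : ℝ × (Fin k → ℝ)) : ℝ := v.1 ^ 2 + ∑ i, v.2 i ^ 2

/-- Growth condition: for every `c₂ > 0` there is `c₁ > 0` with
`|V z| ≤ c₁ exp (c₂ ‖z‖²)`. -/
def GrowthCond {k : ℕ} (V : ℝ × (Fin k → ℝ) → ℝ) : Prop :=
  ∀ c₂ : ℝ, 0 < c₂ → ∃ c₁ : ℝ, 0 < c₁ ∧ ∀ z, |V z| ≤ c₁ * Real.exp (c₂ * sqNorm z)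

/-- `α`-strong convexity (w.r.t. the Euclidean structure). -/
def StrongConvexWith {k : ℕ} (α : ℝ) (V : ℝ × (Fin k → ℝ) → ℝ) : Prop :=
  ∀ x y : ℝ × (Fin k → ℝ), ∀ t : ℝ, t ∈ Set.Icc (0:ℝ) 1 →
    V ((1 - t) • x + t • y) ≤
      (1 - t) * V x + t * V y - α / 2 * t * (1 - t) * sqNorm (x - y)

namespace StarVI

open InformationTheory

/-- If `κ j` are finitely many Markov kernels, the product measures form a measurable family. -/
theorem measurable_pi_kernel {k : ℕ} (κ : Fin k → Kernel ℝ ℝ) (hκ : ∀ j, IsMarkovKernel (κ j)) :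
    Measurable fun z => Measure.pi fun j => κ j z := by
  refine Measurable.measure_of_isPiSystem_of_isProbabilityMeasure
    (generateFrom_pi (α := fun _ : Fin k => ℝ)).symm isPiSystem_pi ?_
  rintro s ⟨t, ht, rfl⟩
  simp only [Measure.pi_pi]
  exact Finset.measurable_prod _ fun j _ => (κ j).measurable_coe (ht j (Set.mem_univ _))

/-- The kernel `z ↦ ∏ⱼ κ j z`. -/
noncomputable def piKernel {k : ℕ} (κ : Fin k → Kernel ℝ ℝ) (hκ : ∀ j, IsMarkovKernel (κ j)) :
    Kernel ℝ (Fin k → ℝ) :=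
  ⟨fun z => Measure.pi fun j => κ j z, measurable_pi_kernel κ hκ⟩

theorem piKernel_apply {k : ℕ} (κ : Fin k → Kernel ℝ ℝ) (hκ : ∀ j, IsMarkovKernel (κ j)) (z : ℝ) :
    piKernel κ hκ z = Measure.pi fun j => κ j z := rfl

instance {k : ℕ} (κ : Fin k → Kernel ℝ ℝ) (hκ : ∀ j, IsMarkovKernel (κ j)) :
    IsMarkovKernel (piKernel κ hκ) :=
  ⟨fun z => by rw [piKernel_apply]; infer_instance⟩

theorem lintegral_pi_prod {n : ℕ} {X : Type*} [MeasurableSpace X] (μ : Fin n → Measure X)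
    [∀ i, SigmaFinite (μ i)] (f : Fin n → X → ℝ≥0∞) (hf : ∀ i, Measurable (f i)) :
    ∫⁻ x, ∏ i, f i (x i) ∂(Measure.pi μ) = ∏ i, ∫⁻ x, f i x ∂(μ i) := by
  induction n with
  | zero => simp
  | succ n ih =>
    have hmp := (measurePreserving_piFinSuccAbove μ 0).symm
    rw [← hmp.lintegral_comp (by fun_prop)]
    have key : ∀ x : X × (Fin n → X),
        ∏ i, f i ((MeasurableEquiv.piFinSuccAbove (fun _ => X) 0).symm x i) =
          f 0 x.1 * ∏ i, f (Fin.succ i) (x.2 i) := by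
      intro x
      rw [Fin.prod_univ_succ]
      rfl
    simp_rw [key]
    rw [lintegral_prod_mul (g := fun y : Fin n → X => ∏ i, f (Fin.succ i) (y i))
      (hf 0).aemeasurable (Finset.measurable_prod _ fun i _ =>
        (hf (Fin.succ i)).comp (measurable_pi_apply i)).aemeasurable, Fin.prod_univ_succ]
    simp only [Fin.zero_succAbove]
    rw [ih (fun i => μ (Fin.succ i)) (fun i => f (Fin.succ i)) fun i => hf _]

theorem pi_withDensity {n : ℕ} {X : Type*} [MeasurableSpace X] (μ : Fin n → Measure X)
    [∀ i, SigmaFinite (μ i)] (f : Fin n → X → ℝ≥0∞) (hf : ∀ i, Measurable (f i))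
    [∀ i, SigmaFinite ((μ i).withDensity (f i))] :
    Measure.pi (fun i => (μ i).withDensity (f i)) =
      (Measure.pi μ).withDensity fun x => ∏ i, f i (x i) := by
  refine Measure.pi_eq fun s hs => ?_
  rw [withDensity_apply _ (MeasurableSet.univ_pi hs),
    ← lintegral_indicator (MeasurableSet.univ_pi hs)]
  have : ∀ x : Fin n → X, (Set.univ.pi s).indicator (fun x => ∏ i, f i (x i)) x
      = ∏ i, (s i).indicator (f i) (x i) := by
    intro x
    by_cases hx : x ∈ Set.univ.pi s
    · rw [Set.indicator_of_mem hx]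
      exact Finset.prod_congr rfl fun i _ => (Set.indicator_of_mem (hx i trivial) _).symm
    · rw [Set.indicator_of_notMem hx]
      simp only [Set.mem_pi, Set.mem_univ, true_implies, not_forall] at hx
      obtain ⟨i, hi⟩ := hx
      exact (Finset.prod_eq_zero (Finset.mem_univ i) (Set.indicator_of_notMem hi _)).symm
  simp_rw [this]
  rw [lintegral_pi_prod _ _ fun i => (hf i).indicator (hs i)]
  refine Finset.prod_congr rfl fun i _ => ?_
  rw [withDensity_apply _ (hs i), lintegral_indicator (hs i)]

theorem klDiv_map_measurableEquiv {X Y : Type*} [MeasurableSpace X] [MeasurableSpace Y]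
    (e : X ≃ᵐ Y) (μ ν : Measure X) [IsFiniteMeasure μ] [IsFiniteMeasure ν] :
    klDiv (μ.map e) (ν.map e) = klDiv μ ν := by
  refine le_antisymm (klDiv_map_le _ _ e.measurable) ?_
  have := klDiv_map_le (μ.map e) (ν.map e) e.symm.measurable
  simpa [Measure.map_map e.symm.measurable e.measurable] using this

theorem klDiv_withDensity {X : Type*} [MeasurableSpace X] (ν : Measure X) [IsFiniteMeasure ν]
    (h : X → ℝ≥0∞) (hh : Measurable h) [IsFiniteMeasure (ν.withDensity h)] :
    klDiv (ν.withDensity h) ν = ∫⁻ x, ENNReal.ofReal (klFun (h x).toReal) ∂ν := by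
  rw [klDiv_eq_lintegral_klFun_of_ac (withDensity_absolutelyContinuous _ _)]
  refine lintegral_congr_ae ?_
  filter_upwards [Measure.rnDeriv_withDensity ν hh] with x hx
  rw [hx]

theorem klDiv_prod {X Y : Type*} [MeasurableSpace X] [MeasurableSpace Y]
    (a c : Measure X) (b d : Measure Y) [IsProbabilityMeasure a] [IsProbabilityMeasure b]
    [IsProbabilityMeasure c] [IsProbabilityMeasure d] :
    klDiv (a.prod b) (c.prod d) = klDiv a c + klDiv b d := by
  have h1 := klDiv_compProd_eq_add a c (Kernel.const X b) (Kernel.const X d)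
  have h2 := klDiv_compProd_left b d (Kernel.const Y a)
  simp only [Measure.compProd_const] at h1 h2
  have h3 := klDiv_map_measurableEquiv MeasurableEquiv.prodComm (a.prod b) (a.prod d)
  change klDiv (Measure.map Prod.swap _) (Measure.map Prod.swap _) = _ at h3
  rw [Measure.prod_swap, Measure.prod_swap] at h3
  rw [h1, ← h3, h2]

theorem klDiv_pi_succAbove {n : ℕ} (i : Fin (n + 1)) (q r : Fin (n + 1) → Measure ℝ)
    [∀ j, IsProbabilityMeasure (q j)] [∀ j, IsProbabilityMeasure (r j)] :
    klDiv (Measure.pi q) (Measure.pi r) = klDiv (q i) (r i) +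
      klDiv (Measure.pi fun j => q (i.succAbove j)) (Measure.pi fun j => r (i.succAbove j)) := by
  rw [← klDiv_map_measurableEquiv (MeasurableEquiv.piFinSuccAbove (fun _ => ℝ) i),
    (measurePreserving_piFinSuccAbove q i).map_eq, (measurePreserving_piFinSuccAbove r i).map_eq,
    klDiv_prod]

theorem measurable_klDiv_kernel {X Y : Type*} [MeasurableSpace X] [MeasurableSpace Y]
    [MeasurableSpace.CountablyGenerated Y]
    (κ η : Kernel X Y) [IsMarkovKernel κ] [IsMarkovKernel η] :
    Measurable fun x => klDiv (κ x) (η x) := by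
  classical
  have : (fun x => klDiv (κ x) (η x)) = fun x => if κ x ≪ η x then
      ∫⁻ y, ENNReal.ofReal (klFun (κ.rnDeriv η x y).toReal) ∂(η x) else ∞ := by
    ext x
    rw [klDiv_eq_lintegral_klFun]
    congr 1
    refine lintegral_congr_ae ?_
    filter_upwards [Kernel.rnDeriv_eq_rnDeriv_measure (κ := κ) (η := η) (a := x)] with y hy
    rw [hy]
  rw [this]
  refine Measurable.ite (Kernel.measurableSet_absolutelyContinuous κ η) ?_ measurable_const
  refine Measurable.lintegral_kernel_prod_right (f := fun x y =>
    ENNReal.ofReal (klFun (κ.rnDeriv η x y).toReal)) ?_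
  have := Kernel.measurable_rnDeriv κ η
  exact ENNReal.measurable_ofReal.comp (measurable_klFun.comp this.ennreal_toReal)

theorem klDiv_compProd_right {X Y : Type*} [MeasurableSpace X] [MeasurableSpace Y]
    [MeasurableSpace.CountablyGenerated Y] (μ : Measure X) [IsProbabilityMeasure μ]
    (κ η : Kernel X Y) [IsMarkovKernel κ] [IsMarkovKernel η] :
    klDiv (μ ⊗ₘ κ) (μ ⊗ₘ η) = ∫⁻ x, klDiv (κ x) (η x) ∂μ := by
  by_cases hac : μ ⊗ₘ κ ≪ μ ⊗ₘ η
  · have hae := Measure.absolutelyContinuous_compProd_right_iff.mp hac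
    have hm : Measurable (Function.uncurry (κ.rnDeriv η)) := Kernel.measurable_rnDeriv κ η
    have e1 : ∀ᵐ x ∂μ, κ x = (η x).withDensity (κ.rnDeriv η x) := by
      filter_upwards [hae] with x hx
      rw [← Kernel.withDensity_apply η hm, Kernel.withDensity_rnDeriv_eq hx]
    have e2 : μ ⊗ₘ κ = (μ ⊗ₘ η).withDensity (Function.uncurry (κ.rnDeriv η)) := by
      have : κ =ᵐ[μ] η.withDensity (κ.rnDeriv η) := by
        filter_upwards [e1] with x hx
        rw [Kernel.withDensity_apply η hm, ← hx]
      have hsf : IsSFiniteKernel (η.withDensity (κ.rnDeriv η)) := inferInstance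
      rw [Measure.compProd_congr this, Measure.compProd_withDensity hm]
      rfl
    have h3 : Measurable fun p : X × Y =>
        ENNReal.ofReal (klFun ((Function.uncurry (κ.rnDeriv η)) p).toReal) :=
      ENNReal.measurable_ofReal.comp (measurable_klFun.comp hm.ennreal_toReal)
    have hfin : IsFiniteMeasure ((μ ⊗ₘ η).withDensity (Function.uncurry (κ.rnDeriv η))) := by
      rw [← e2]; infer_instance
    rw [e2, klDiv_withDensity _ _ hm, Measure.lintegral_compProd h3]
    refine lintegral_congr_ae ?_
    filter_upwards [e1] with x hx
    have hfin : IsFiniteMeasure ((η x).withDensity (κ.rnDeriv η x)) := by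
      rw [← hx]; infer_instance
    rw [hx, klDiv_withDensity _ _ (Kernel.measurable_rnDeriv_right κ η x)]
    rfl
  · rw [klDiv_of_not_ac hac]
    by_contra hne
    refine hac (Measure.absolutelyContinuous_compProd_right_iff.mpr ?_)
    filter_upwards [ae_lt_top (measurable_klDiv_kernel κ η) (Ne.symm hne)] with x hx
    exact (klDiv_ne_top_iff.mp hx.ne).1

/-- `exp (-E)` for an extended nonnegative energy `E`, with `exp (-∞) = 0`. -/
noncomputable def boltz (E : ℝ≥0∞) : ℝ≥0∞ :=
  if E = ∞ then 0 else ENNReal.ofReal (Real.exp (-E.toReal))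

@[simp] theorem boltz_top : boltz ∞ = 0 := by simp [boltz]

theorem boltz_of_ne_top {E : ℝ≥0∞} (h : E ≠ ∞) :
    boltz E = ENNReal.ofReal (Real.exp (-E.toReal)) := by simp [boltz, h]

theorem boltz_ofReal {x : ℝ} (hx : 0 ≤ x) :
    boltz (ENNReal.ofReal x) = ENNReal.ofReal (Real.exp (-x)) := by
  rw [boltz_of_ne_top ENNReal.ofReal_ne_top, ENNReal.toReal_ofReal hx]

theorem boltz_le_one (E : ℝ≥0∞) : boltz E ≤ 1 := by
  by_cases h : E = ∞
  · simp [h]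
  · rw [boltz_of_ne_top h, ENNReal.ofReal_le_one, Real.exp_le_one_iff]
    simp

theorem boltz_eq_zero {E : ℝ≥0∞} : boltz E = 0 ↔ E = ∞ := by
  refine ⟨fun h => ?_, fun h => by simp [h]⟩
  by_contra hE
  rw [boltz_of_ne_top hE, ENNReal.ofReal_eq_zero] at h
  exact absurd h (not_le.mpr (Real.exp_pos _))

theorem measurable_boltz : Measurable boltz :=
  Measurable.ite (measurableSet_singleton _) measurable_const (by fun_prop)

theorem measurable_boltz_comp {X : Type*} [MeasurableSpace X] {E : X → ℝ≥0∞}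
    (hE : Measurable E) : Measurable fun x => boltz (E x) := measurable_boltz.comp hE

/-- The partition function `∫ exp (-E) dρ`. -/
noncomputable def partition {X : Type*} [MeasurableSpace X] (ρ : Measure X) (E : X → ℝ≥0∞) :
    ℝ≥0∞ := ∫⁻ x, boltz (E x) ∂ρ

/-- The probability measure proportional to `exp (-E) ρ`. -/
noncomputable def gibbsTilt {X : Type*} [MeasurableSpace X] (ρ : Measure X) (E : X → ℝ≥0∞) :
    Measure X := (partition ρ E)⁻¹ • ρ.withDensity fun x => boltz (E x)

section Gibbs
variable {X : Type*} [MeasurableSpace X] {ρ : Measure X} {E : X → ℝ≥0∞}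

theorem partition_le_one [IsProbabilityMeasure ρ] : partition ρ E ≤ 1 :=
  (lintegral_mono fun x => boltz_le_one (E x)).trans (by simp)

theorem partition_ne_top [IsProbabilityMeasure ρ] : partition ρ E ≠ ∞ :=
  (partition_le_one.trans_lt ENNReal.one_lt_top).ne

theorem partition_ne_zero [IsProbabilityMeasure ρ] (hE : Measurable E) {q : Measure X}
    [IsProbabilityMeasure q] (hq : q ≪ ρ) (hfin : ∀ᵐ x ∂q, E x ≠ ∞) : partition ρ E ≠ 0 := by
  intro h
  rw [partition, lintegral_eq_zero_iff (measurable_boltz_comp hE)] at h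
  have h' := hq.ae_le h
  have : ∀ᵐ x ∂q, False := by
    filter_upwards [h', hfin] with x h1 h2
    exact h2 (boltz_eq_zero.mp h1)
  exact IsProbabilityMeasure.ne_zero q (by simpa using this)

theorem isProbabilityMeasure_gibbsTilt [IsProbabilityMeasure ρ] (h0 : partition ρ E ≠ 0) :
    IsProbabilityMeasure (gibbsTilt ρ E) := by
  refine ⟨?_⟩
  rw [gibbsTilt, Measure.smul_apply, withDensity_apply _ MeasurableSet.univ, setLIntegral_univ,
    smul_eq_mul]
  exact ENNReal.inv_mul_cancel h0 partition_ne_top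

theorem gibbsTilt_eq_withDensity (hE : Measurable E) :
    gibbsTilt ρ E = ρ.withDensity fun x => (partition ρ E)⁻¹ * boltz (E x) := by
  rw [gibbsTilt, ← withDensity_smul _ (measurable_boltz_comp hE)]
  rfl

theorem gibbsTilt_absolutelyContinuous : gibbsTilt ρ E ≪ ρ :=
  (withDensity_absolutelyContinuous _ _).smul_left _

theorem ae_gibbsTilt_ne_top (hE : Measurable E) : ∀ᵐ x ∂(gibbsTilt ρ E), E x ≠ ∞ := by
  refine Measure.ae_smul_measure ?_ _
  rw [ae_withDensity_iff (measurable_boltz_comp hE)]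
  exact ae_of_all _ fun x hx h => hx (by simp [h])

theorem absolutelyContinuous_gibbsTilt [IsProbabilityMeasure ρ] (hE : Measurable E)
    (hfin : ∀ᵐ x ∂ρ, E x ≠ ∞) : ρ ≪ gibbsTilt ρ E := by
  rw [gibbsTilt_eq_withDensity hE]
  refine withDensity_absolutelyContinuous'
    ((measurable_boltz_comp hE).const_mul _).aemeasurable ?_
  filter_upwards [hfin] with x hx
  exact mul_ne_zero (ENNReal.inv_ne_zero.mpr partition_ne_top) (mt boltz_eq_zero.mp hx)

theorem klFun_gibbs_identity {g e n : ℝ} (hg : 0 ≤ g) (hn : 0 < n) :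
    n⁻¹ * Real.exp (-e) * klFun (g * n / Real.exp (-e)) + g * -Real.log n + 1 =
      klFun g + g * e + n⁻¹ * Real.exp (-e) := by
  have hb := Real.exp_pos (-e)
  rcases hg.eq_or_lt with rfl | hg
  · simp [klFun_apply]; ring
  · rw [klFun_apply, klFun_apply, Real.log_div (by positivity) hb.ne',
      Real.log_mul hg.ne' hn.ne', Real.log_exp]
    field_simp
    ring

/-- **Gibbs variational identity**, in `ℝ≥0∞`. -/
theorem klDiv_add_lintegral_eq [IsProbabilityMeasure ρ] (hE : Measurable E) {q : Measure X}
    [IsProbabilityMeasure q] (hq : q ≪ ρ) (hfin : ∀ᵐ x ∂q, E x ≠ ∞) :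
    klDiv q ρ + ∫⁻ x, E x ∂q =
      klDiv q (gibbsTilt ρ E) + ENNReal.ofReal (-Real.log (partition ρ E).toReal) := by
  have h0 := partition_ne_zero hE hq hfin
  have hprob := isProbabilityMeasure_gibbsTilt h0
  set n := partition ρ E with hn
  have hnt : n ≠ ∞ := partition_ne_top
  have hnpos : 0 < n.toReal := ENNReal.toReal_pos h0 hnt
  have hlog : 0 ≤ -Real.log n.toReal := by
    rw [neg_nonneg]
    refine Real.log_nonpos hnpos.le ?_
    exact ENNReal.toReal_le_of_le_ofReal zero_le_one (by simpa using partition_le_one)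
  set g := q.rnDeriv ρ with hgdef
  have hgm : Measurable g := Measure.measurable_rnDeriv _ _
  have hqg : ρ.withDensity g = q := Measure.withDensity_rnDeriv_eq _ _ hq
  have hbm : Measurable fun x => boltz (E x) := measurable_boltz_comp hE
  have hgfin : ∀ᵐ x ∂ρ, g x < ∞ := Measure.rnDeriv_lt_top q ρ
  have hg0 : ∀ᵐ x ∂ρ, E x = ∞ → g x = 0 := by
    rw [← hqg, ae_withDensity_iff hgm] at hfin
    filter_upwards [hfin] with x hx h
    by_contra h'
    exact hx h' h
  set h : X → ℝ≥0∞ := fun x => g x * n / boltz (E x) with hh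
  have hhm : Measurable h := (hgm.mul_const _).div hbm
  have hν : gibbsTilt ρ E = ρ.withDensity fun x => n⁻¹ * boltz (E x) :=
    gibbsTilt_eq_withDensity hE
  have hqh : q = (gibbsTilt ρ E).withDensity h := by
    rw [hν, ← withDensity_mul _ (hbm.const_mul _) hhm, ← hqg]
    refine withDensity_congr_ae ?_
    filter_upwards [hg0] with x hx
    simp only [Pi.mul_apply, hh]
    by_cases hb : E x = ∞
    · simp [hx hb, hb]
    · have hb0 : boltz (E x) ≠ 0 := mt boltz_eq_zero.mp hb
      have hbt : boltz (E x) ≠ ∞ := ((boltz_le_one _).trans_lt ENNReal.one_lt_top).ne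
      rw [mul_comm n⁻¹, mul_assoc, mul_comm, mul_assoc, ENNReal.div_mul_cancel hb0 hbt, mul_comm,
        mul_assoc, ENNReal.mul_inv_cancel h0 hnt, mul_one]
  have hfq : IsFiniteMeasure ((gibbsTilt ρ E).withDensity h) := by rw [← hqh]; infer_instance
  have hfq' : IsFiniteMeasure (ρ.withDensity g) := by rw [hqg]; infer_instance
  have hklm : ∀ {u : X → ℝ≥0∞}, Measurable u →
      Measurable fun x => ENNReal.ofReal (klFun (u x).toReal) := fun hu =>
    ENNReal.measurable_ofReal.comp (measurable_klFun.comp hu.ennreal_toReal)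
  have k1 : klDiv q (gibbsTilt ρ E) =
      ∫⁻ x, n⁻¹ * boltz (E x) * ENNReal.ofReal (klFun (h x).toReal) ∂ρ := by
    conv_lhs => rw [hqh]
    rw [klDiv_withDensity _ _ hhm]
    nth_rw 1 [hν]
    rw [lintegral_withDensity_eq_lintegral_mul _ (hbm.const_mul _)
      (hklm hhm)]
    rfl
  have k2 : klDiv q ρ = ∫⁻ x, ENNReal.ofReal (klFun (g x).toReal) ∂ρ := by
    rw [← hqg, klDiv_withDensity _ _ hgm]
  have k3 : ∫⁻ x, E x ∂q = ∫⁻ x, g x * E x ∂ρ := by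
    conv_lhs => rw [← hqg]
    rw [lintegral_withDensity_eq_lintegral_mul _ hgm hE]
    rfl
  have k4 : ∫⁻ x, g x * ENNReal.ofReal (-Real.log n.toReal) ∂ρ =
      ENNReal.ofReal (-Real.log n.toReal) := by
    rw [lintegral_mul_const _ hgm, Measure.lintegral_rnDeriv hq, measure_univ, one_mul]
  have k5 : ∫⁻ x, n⁻¹ * boltz (E x) ∂ρ = 1 := by
    rw [lintegral_const_mul _ hbm]
    exact ENNReal.inv_mul_cancel h0 hnt
  have main : (klDiv q (gibbsTilt ρ E) + ENNReal.ofReal (-Real.log n.toReal)) + 1 =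
      (klDiv q ρ + ∫⁻ x, E x ∂q) + 1 := by
    conv_lhs => rw [k1, ← k4, ← lintegral_add_left (by fun_prop)]
    conv_rhs => rw [k2, k3, ← lintegral_add_left (hklm hgm), ← k5,
      ← lintegral_add_left (show Measurable fun x =>
        ENNReal.ofReal (klFun (g x).toReal) + g x * E x from (hklm hgm).add (hgm.mul hE))]
    have one : (1 : ℝ≥0∞) = ∫⁻ _, 1 ∂ρ := by simp
    conv_lhs => rw [one, ← lintegral_add_right _ measurable_const]
    refine lintegral_congr_ae ?_
    filter_upwards [hg0, hgfin] with x hx hgx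
    by_cases hb : E x = ∞
    · simp [hb, hx hb, klFun_zero]
    · set G := (g x).toReal
      set e := (E x).toReal
      have hG : g x = ENNReal.ofReal G := (ENNReal.ofReal_toReal hgx.ne).symm
      have he : E x = ENNReal.ofReal e := (ENNReal.ofReal_toReal hb).symm
      have hN : n⁻¹ = ENNReal.ofReal n.toReal⁻¹ := by
        rw [ENNReal.ofReal_inv_of_pos hnpos, ENNReal.ofReal_toReal hnt]
      have hG0 : 0 ≤ G := ENNReal.toReal_nonneg
      have he0 : 0 ≤ e := ENNReal.toReal_nonneg
      have hhx : (h x).toReal = G * n.toReal / Real.exp (-e) := by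
        simp only [hh, ENNReal.toReal_div, ENNReal.toReal_mul, boltz_of_ne_top hb]
        rw [ENNReal.toReal_ofReal (Real.exp_pos _).le]
      have hk1 : 0 ≤ klFun (G * n.toReal / Real.exp (-e)) := klFun_nonneg (by positivity)
      have hk2 : 0 ≤ klFun G := klFun_nonneg hG0
      rw [hhx, boltz_of_ne_top hb, hN, hG, he, ENNReal.toReal_ofReal he0]
      have he' := Real.exp_pos (-e)
      rw [← ENNReal.ofReal_one, ← ENNReal.ofReal_mul (by positivity),
        ← ENNReal.ofReal_mul (by positivity), ← ENNReal.ofReal_mul (by positivity),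
        ← ENNReal.ofReal_mul (by positivity), ← ENNReal.ofReal_add (by positivity) (by positivity),
        ← ENNReal.ofReal_add (by positivity) zero_le_one,
        ← ENNReal.ofReal_add hk2 (by positivity),
        ← ENNReal.ofReal_add (by positivity) (by positivity), klFun_gibbs_identity hG0 hnpos]
  exact ((ENNReal.add_left_inj ENNReal.one_ne_top).mp main).symm

theorem klDiv_gibbsTilt_add_lintegral [IsProbabilityMeasure ρ] (hE : Measurable E)
    (h0 : partition ρ E ≠ 0) :
    klDiv (gibbsTilt ρ E) ρ + ∫⁻ x, E x ∂(gibbsTilt ρ E) =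
      ENNReal.ofReal (-Real.log (partition ρ E).toReal) := by
  have := isProbabilityMeasure_gibbsTilt h0
  rw [klDiv_add_lintegral_eq hE gibbsTilt_absolutelyContinuous (ae_gibbsTilt_ne_top hE),
    klDiv_self, zero_add]

/-- For a finite energy, the Gibbs identity holds for every probability measure. -/
theorem klDiv_add_lintegral_eq_of_ne_top [IsProbabilityMeasure ρ] (hE : Measurable E)
    (hfin : ∀ x, E x ≠ ∞) {q : Measure X} [IsProbabilityMeasure q] :
    klDiv q ρ + ∫⁻ x, E x ∂q =
      klDiv q (gibbsTilt ρ E) + ENNReal.ofReal (-Real.log (partition ρ E).toReal) := by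
  by_cases hq : q ≪ ρ
  · exact klDiv_add_lintegral_eq hE hq (ae_of_all _ hfin)
  · rw [klDiv_of_not_ac hq, klDiv_of_not_ac fun h => hq (h.trans gibbsTilt_absolutelyContinuous)]
    simp

end Gibbs

/-- The conditional free energy of the leaves given the root, relative to the reference `γ^{⊗k}`
and the energy `T`. -/
noncomputable def freeEnergy {k : ℕ} (γ : Measure ℝ) (T : ℝ × (Fin k → ℝ) → ℝ≥0∞)
    (κ : Fin k → Kernel ℝ ℝ) (z : ℝ) : ℝ≥0∞ :=
  klDiv (Measure.pi fun j => κ j z) (Measure.pi fun _ => γ) +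
    ∫⁻ y, T (z, y) ∂(Measure.pi fun j => κ j z)

/-- `(p, κ)` minimizes the free energy over all star-structured probability measures, with a finite
minimal value. -/
structure IsMinimizer {k : ℕ} (γ : Measure ℝ) (T : ℝ × (Fin k → ℝ) → ℝ≥0∞) (p : Measure ℝ)
    (κ : Fin k → Kernel ℝ ℝ) : Prop where
  prob : IsProbabilityMeasure p
  markov : ∀ j, IsMarkovKernel (κ j)
  ne_top : klDiv p γ + ∫⁻ z, freeEnergy γ T κ z ∂p ≠ ∞
  le : ∀ (p' : Measure ℝ) (κ' : Fin k → Kernel ℝ ℝ), IsProbabilityMeasure p' →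
    (∀ j, IsMarkovKernel (κ' j)) → klDiv p γ + ∫⁻ z, freeEnergy γ T κ z ∂p ≤
      klDiv p' γ + ∫⁻ z, freeEnergy γ T κ' z ∂p'

/-- Follow `κ₁` on `S` and `κ₂` off `S`. -/
noncomputable def switch {k : ℕ} {S : Set ℝ} (hS : MeasurableSet S) (κ₁ κ₂ : Fin k → Kernel ℝ ℝ) :
    Fin k → Kernel ℝ ℝ := by
  classical exact fun j => Kernel.piecewise hS (κ₁ j) (κ₂ j)

theorem freeEnergy_switch_mem {k : ℕ} {γ : Measure ℝ}
    {T : ℝ × (Fin k → ℝ) → ℝ≥0∞} {S : Set ℝ} (hS : MeasurableSet S)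
    (κ₁ κ₂ : Fin k → Kernel ℝ ℝ) {z : ℝ} (hz : z ∈ S) :
    freeEnergy γ T (switch hS κ₁ κ₂) z = freeEnergy γ T κ₁ z := by
  simp [freeEnergy, switch, Kernel.piecewise_apply, hz]

theorem freeEnergy_switch_notMem {k : ℕ} {γ : Measure ℝ}
    {T : ℝ × (Fin k → ℝ) → ℝ≥0∞} {S : Set ℝ} (hS : MeasurableSet S)
    (κ₁ κ₂ : Fin k → Kernel ℝ ℝ) {z : ℝ} (hz : z ∉ S) :
    freeEnergy γ T (switch hS κ₁ κ₂) z = freeEnergy γ T κ₂ z := by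
  simp [freeEnergy, switch, Kernel.piecewise_apply, hz]

section
variable {k : ℕ} {γ : Measure ℝ} [IsProbabilityMeasure γ] {T : ℝ × (Fin k → ℝ) → ℝ≥0∞}
  {p : Measure ℝ} {κ : Fin k → Kernel ℝ ℝ}

theorem measurable_lintegral_pi_kernel (hT : Measurable T) (hκ : ∀ j, IsMarkovKernel (κ j)) :
    Measurable fun z => ∫⁻ y, T (z, y) ∂(Measure.pi fun j => κ j z) :=
  hT.lintegral_kernel_prod_right' (κ := piKernel κ hκ)

theorem measurable_freeEnergy (hT : Measurable T) (hκ : ∀ j, IsMarkovKernel (κ j)) :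
    Measurable (freeEnergy γ T κ) := by
  have h1 := measurable_klDiv_kernel (piKernel κ hκ) (Kernel.const ℝ (Measure.pi fun _ => γ))
  exact h1.add (measurable_lintegral_pi_kernel hT hκ)

theorem klDiv_compProd_add_lintegral (hT : Measurable T) [IsProbabilityMeasure p]
    (hκ : ∀ j, IsMarkovKernel (κ j)) :
    klDiv (p ⊗ₘ piKernel κ hκ) (γ.prod (Measure.pi fun _ => γ)) +
      ∫⁻ x, T x ∂(p ⊗ₘ piKernel κ hκ) = klDiv p γ + ∫⁻ z, freeEnergy γ T κ z ∂p := by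
  have h1 := klDiv_compProd_eq_add p γ (piKernel κ hκ)
    (Kernel.const ℝ (Measure.pi fun _ : Fin k => γ))
  rw [klDiv_compProd_right, Measure.compProd_const] at h1
  have hm := measurable_klDiv_kernel (piKernel κ hκ) (Kernel.const ℝ (Measure.pi fun _ => γ))
  rw [h1, Measure.lintegral_compProd hT, add_assoc, ← lintegral_add_left hm]
  rfl

theorem freeEnergy_const (z : ℝ) : freeEnergy γ T (fun _ => Kernel.const ℝ γ) z =
    ∫⁻ y, T (z, y) ∂(Measure.pi fun _ => γ) := by
  simp [freeEnergy]

theorem isMarkovKernel_switch {S : Set ℝ} (hS : MeasurableSet S) {κ₁ κ₂ : Fin k → Kernel ℝ ℝ}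
    (h₁ : ∀ j, IsMarkovKernel (κ₁ j)) (h₂ : ∀ j, IsMarkovKernel (κ₂ j)) (j : Fin k) :
    IsMarkovKernel (switch hS κ₁ κ₂ j) := by
  have := h₁ j
  have := h₂ j
  unfold switch
  infer_instance

namespace IsMinimizer

theorem eq_gibbsTilt_and_ae_eq (h : IsMinimizer γ T p κ) (hT : Measurable T)
    {κ' : Fin k → Kernel ℝ ℝ} (hκ' : ∀ j, IsMarkovKernel (κ' j))
    (hle : ∀ᵐ z ∂p, freeEnergy γ T κ' z ≤ freeEnergy γ T κ z) :
    p = gibbsTilt γ (freeEnergy γ T κ') ∧ freeEnergy γ T κ' =ᵐ[p] freeEnergy γ T κ := by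
  have := h.prob
  have hm := measurable_freeEnergy (γ := γ) hT hκ'
  have hfin := ENNReal.add_ne_top.mp h.ne_top
  have hac : p ≪ γ := (klDiv_ne_top_iff.mp hfin.1).1
  have hI : ∫⁻ z, freeEnergy γ T κ' z ∂p ≤ ∫⁻ z, freeEnergy γ T κ z ∂p :=
    lintegral_mono_ae hle
  have hI' : ∫⁻ z, freeEnergy γ T κ' z ∂p ≠ ∞ := (hI.trans_lt hfin.2.lt_top).ne
  have hfin' : ∀ᵐ z ∂p, freeEnergy γ T κ' z ≠ ∞ :=
    (ae_lt_top hm hI').mono fun z hz => hz.ne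
  have h0 := partition_ne_zero hm hac hfin'
  have hprob := isProbabilityMeasure_gibbsTilt h0
  have e1 := klDiv_add_lintegral_eq hm hac hfin'
  have e2 := klDiv_gibbsTilt_add_lintegral hm h0
  have e3 := h.le _ κ' hprob hκ'
  rw [e2] at e3
  have e4 : klDiv p (gibbsTilt γ (freeEnergy γ T κ')) = 0 := by
    have : klDiv p (gibbsTilt γ (freeEnergy γ T κ')) +
        ENNReal.ofReal (-Real.log (partition γ (freeEnergy γ T κ')).toReal) ≤
        0 + ENNReal.ofReal (-Real.log (partition γ (freeEnergy γ T κ')).toReal) := by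
      rw [← e1, zero_add]
      exact (add_le_add_right hI _).trans e3
    exact le_antisymm (ENNReal.le_of_add_le_add_right ENNReal.ofReal_ne_top this) bot_le
  refine ⟨klDiv_eq_zero_iff.mp e4, ?_⟩
  rw [e4, zero_add] at e1
  rw [← e1] at e3
  exact ae_eq_of_ae_le_of_lintegral_le hle hI'
    (measurable_freeEnergy hT h.markov).aemeasurable (ENNReal.le_of_add_le_add_left hfin.1 e3)

theorem eq_gibbsTilt (h : IsMinimizer γ T p κ) (hT : Measurable T) :
    p = gibbsTilt γ (freeEnergy γ T κ) :=
  (h.eq_gibbsTilt_and_ae_eq hT h.markov (ae_of_all _ fun _ => le_rfl)).1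

theorem absolutelyContinuous (h : IsMinimizer γ T p κ) (hT : Measurable T) : p ≪ γ := by
  rw [h.eq_gibbsTilt hT]
  exact gibbsTilt_absolutelyContinuous

theorem reference_absolutelyContinuous (h : IsMinimizer γ T p κ) (hT : Measurable T)
    (hfin : ∀ z, ∫⁻ y, T (z, y) ∂(Measure.pi fun _ => γ) ≠ ∞) : γ ≪ p := by
  have hm := measurable_freeEnergy (γ := γ) hT h.markov
  set S := {z | freeEnergy γ T κ z = ∞}
  have hS : MeasurableSet S := hm (measurableSet_singleton _)
  have hκ' := isMarkovKernel_switch hS (κ₁ := fun _ => Kernel.const ℝ γ) (κ₂ := κ)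
    (fun j => inferInstance) h.markov
  have hle : ∀ z, freeEnergy γ T (switch hS (fun _ => Kernel.const ℝ γ) κ) z ≤
      freeEnergy γ T κ z := by
    intro z
    by_cases hz : z ∈ S
    · rw [show freeEnergy γ T κ z = ∞ from hz]
      exact le_top
    · rw [freeEnergy_switch_notMem hS _ _ hz]
  rw [(h.eq_gibbsTilt_and_ae_eq hT hκ' (ae_of_all _ hle)).1]
  refine absolutelyContinuous_gibbsTilt (measurable_freeEnergy hT hκ') (ae_of_all _ fun z => ?_)
  by_cases hz : z ∈ S
  · rw [freeEnergy_switch_mem hS _ _ hz, freeEnergy_const]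
    exact hfin z
  · rw [freeEnergy_switch_notMem hS _ _ hz]
    exact hz

theorem freeEnergy_ae_le (h : IsMinimizer γ T p κ) (hT : Measurable T)
    (hfin : ∀ z, ∫⁻ y, T (z, y) ∂(Measure.pi fun _ => γ) ≠ ∞)
    {κ' : Fin k → Kernel ℝ ℝ} (hκ' : ∀ j, IsMarkovKernel (κ' j)) :
    ∀ᵐ z ∂γ, freeEnergy γ T κ z ≤ freeEnergy γ T κ' z := by
  refine (h.reference_absolutelyContinuous hT hfin).ae_le ?_
  have hS : MeasurableSet {z | freeEnergy γ T κ' z < freeEnergy γ T κ z} :=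
    measurableSet_lt (measurable_freeEnergy hT hκ') (measurable_freeEnergy hT h.markov)
  have hle : ∀ z, freeEnergy γ T (switch hS κ' κ) z ≤ freeEnergy γ T κ z := by
    intro z
    by_cases hz : z ∈ {z | freeEnergy γ T κ' z < freeEnergy γ T κ z}
    · rw [freeEnergy_switch_mem hS _ _ hz]
      exact le_of_lt hz
    · rw [freeEnergy_switch_notMem hS _ _ hz]
  filter_upwards [(h.eq_gibbsTilt_and_ae_eq hT (isMarkovKernel_switch hS hκ' h.markov)
    (ae_of_all _ hle)).2] with z hz
  by_contra hlt
  rw [not_le] at hlt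
  rw [freeEnergy_switch_mem hS _ _ hlt] at hz
  exact hlt.ne hz

theorem freeEnergy_ae_ne_top (h : IsMinimizer γ T p κ) (hT : Measurable T)
    (hfin : ∀ z, ∫⁻ y, T (z, y) ∂(Measure.pi fun _ => γ) ≠ ∞) :
    ∀ᵐ z ∂γ, freeEnergy γ T κ z ≠ ∞ := by
  refine (h.reference_absolutelyContinuous hT hfin).ae_le ?_
  have := ae_gibbsTilt_ne_top (ρ := γ) (measurable_freeEnergy (γ := γ) hT h.markov)
  rwa [← h.eq_gibbsTilt hT] at this

end IsMinimizer
end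

theorem lintegral_pi_insertNth {n : ℕ} (i : Fin (n + 1)) (q : Fin (n + 1) → Measure ℝ)
    [∀ j, IsProbabilityMeasure (q j)] {f : (Fin (n + 1) → ℝ) → ℝ≥0∞} (hf : Measurable f) :
    ∫⁻ y, f y ∂(Measure.pi q) = ∫⁻ x, ∫⁻ w, f (i.insertNth x w)
      ∂(Measure.pi fun j => q (i.succAbove j)) ∂(q i) := by
  have hmp := (measurePreserving_piFinSuccAbove q i).symm
  rw [← hmp.lintegral_comp hf, lintegral_prod]
  · rfl
  · exact (hf.comp (MeasurableEquiv.measurable _)).aemeasurable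

theorem lintegral_pi_update {n : ℕ} (i : Fin (n + 1)) (q : Fin (n + 1) → Measure ℝ)
    [∀ j, IsProbabilityMeasure (q j)] {f : (Fin (n + 1) → ℝ) → ℝ≥0∞} (hf : Measurable f) (x : ℝ) :
    ∫⁻ y, f (Function.update y i x) ∂(Measure.pi q) =
      ∫⁻ w, f (i.insertNth x w) ∂(Measure.pi fun j => q (i.succAbove j)) := by
  rw [lintegral_pi_insertNth i q (f := fun y => f (Function.update y i x))
    (hf.comp (measurable_update' (a := i) |>.comp (measurable_id.prodMk measurable_const)))]
  simp [Fin.update_insertNth]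

/-- The mean energy felt by the leaf `i` at position `x` when the root sits at `z`. -/
noncomputable def leafEnergy {k : ℕ} (T : ℝ × (Fin k → ℝ) → ℝ≥0∞) (κ : Fin k → Kernel ℝ ℝ)
    (i : Fin k) (z x : ℝ) : ℝ≥0∞ :=
  ∫⁻ y, T (z, Function.update y i x) ∂(Measure.pi fun j => κ j z)

theorem measurable_leafEnergy {k : ℕ} {T : ℝ × (Fin k → ℝ) → ℝ≥0∞} (hT : Measurable T)
    {κ : Fin k → Kernel ℝ ℝ} (hκ : ∀ j, IsMarkovKernel (κ j)) (i : Fin k) :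
    Measurable (Function.uncurry (leafEnergy T κ i)) := by
  refine Measurable.lintegral_kernel_prod_right'
    (κ := (piKernel κ hκ).comap (Prod.fst : ℝ × ℝ → ℝ) measurable_fst)
    (f := fun q : (ℝ × ℝ) × (Fin k → ℝ) => T (q.1.1, Function.update q.2 i q.1.2)) ?_
  exact hT.comp ((measurable_fst.comp measurable_fst).prodMk ((measurable_update' (a := i)).comp
    (measurable_snd.prodMk (measurable_snd.comp measurable_fst))))

section
variable {n : ℕ} {γ : Measure ℝ} [IsProbabilityMeasure γ] {T : ℝ × (Fin (n + 1) → ℝ) → ℝ≥0∞}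
  {p : Measure ℝ} {κ : Fin (n + 1) → Kernel ℝ ℝ}

theorem freeEnergy_update (hT : Measurable T) (hκ : ∀ j, IsMarkovKernel (κ j))
    (i : Fin (n + 1)) (ν : Kernel ℝ ℝ) [IsMarkovKernel ν] (z : ℝ) :
    freeEnergy γ T (Function.update κ i ν) z =
      klDiv (Measure.pi fun j => κ (i.succAbove j) z) (Measure.pi fun _ => γ) +
        (klDiv (ν z) γ + ∫⁻ x, leafEnergy T κ i z x ∂(ν z)) := by
  have hκ' : ∀ j, IsMarkovKernel (Function.update κ i ν j) := by
    intro j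
    by_cases hj : j = i
    · subst hj
      simpa
    · simpa [hj] using hκ j
  have hTz : Measurable fun y => T (z, y) := hT.comp measurable_prodMk_left
  rw [freeEnergy, klDiv_pi_succAbove i, lintegral_pi_insertNth i _ hTz]
  simp only [Function.update_self, ne_eq, Fin.succAbove_ne, not_false_eq_true,
    Function.update_of_ne, leafEnergy]
  simp_rw [lintegral_pi_update i (fun j => κ j z) hTz]
  ring

theorem measurable_partition_leafEnergy (hT : Measurable T) (hκ : ∀ j, IsMarkovKernel (κ j))
    (i : Fin (n + 1)) : Measurable fun z => partition γ (leafEnergy T κ i z) :=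
  (measurable_boltz_comp (measurable_leafEnergy hT hκ i)).lintegral_prod_right'

open Classical in
/-- The kernel `z ↦ gibbsTilt γ (leafEnergy z)`, with value `γ` where the energy is degenerate. -/
noncomputable def leafKernel (γ : Measure ℝ) [IsProbabilityMeasure γ] (hT : Measurable T)
    (hκ : ∀ j, IsMarkovKernel (κ j)) (i : Fin (n + 1)) : Kernel ℝ ℝ :=
  Kernel.piecewise (measurable_partition_leafEnergy (γ := γ) hT hκ i (measurableSet_singleton 0))
    (Kernel.const ℝ γ) (Kernel.withDensity (Kernel.const ℝ γ) fun z x =>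
      (partition γ (leafEnergy T κ i z))⁻¹ * boltz (leafEnergy T κ i z x))

theorem leafKernel_apply (hT : Measurable T)
    (hκ : ∀ j, IsMarkovKernel (κ j)) (i : Fin (n + 1)) {z : ℝ}
    (hz : partition γ (leafEnergy T κ i z) ≠ 0) :
    leafKernel γ hT hκ i z = gibbsTilt γ (leafEnergy T κ i z) := by
  classical
  have hE := measurable_leafEnergy hT hκ i
  rw [gibbsTilt_eq_withDensity (E := leafEnergy T κ i z) (hE.comp measurable_prodMk_left),
    leafKernel, Kernel.piecewise_apply,
    if_neg (by simpa using hz), Kernel.withDensity_apply]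
  · rfl
  · exact ((measurable_partition_leafEnergy hT hκ i).inv.comp measurable_fst).mul
      (measurable_boltz_comp hE)

instance (hT : Measurable T) (hκ : ∀ j, IsMarkovKernel (κ j)) (i : Fin (n + 1)) :
    IsMarkovKernel (leafKernel γ hT hκ i) := by
  refine ⟨fun z => ?_⟩
  by_cases hz : partition γ (leafEnergy T κ i z) = 0
  · classical
    rw [leafKernel, Kernel.piecewise_apply, if_pos (by simpa using hz)]
    infer_instance
  · rw [leafKernel_apply hT hκ i hz]
    exact isProbabilityMeasure_gibbsTilt hz

theorem IsMinimizer.leaf (h : IsMinimizer γ T p κ) (hT : Measurable T)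
    (hfin : ∀ z, ∫⁻ y, T (z, y) ∂(Measure.pi fun _ => γ) ≠ ∞) (i : Fin (n + 1)) :
    ∀ᵐ z ∂γ, partition γ (leafEnergy T κ i z) ≠ 0 ∧
      κ i z = gibbsTilt γ (leafEnergy T κ i z) ∧
      ENNReal.ofReal (-Real.log (partition γ (leafEnergy T κ i z)).toReal) ≤
        freeEnergy γ T κ z := by
  have hκ := h.markov
  have hκ' : ∀ j, IsMarkovKernel (Function.update κ i (leafKernel γ hT hκ i) j) := by
    intro j
    by_cases hj : j = i
    · subst hj
      simp only [Function.update_self]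
      infer_instance
    · simpa [hj] using hκ j
  filter_upwards [h.freeEnergy_ae_ne_top hT hfin, h.freeEnergy_ae_le hT hfin hκ'] with z hz hle
  have hE : Measurable (leafEnergy T κ i z) :=
    (measurable_leafEnergy hT hκ i).comp measurable_prodMk_left
  have e1 := freeEnergy_update (γ := γ) hT hκ i (κ i) z
  rw [Function.update_eq_self] at e1
  have hz' := hz
  rw [e1] at hz'
  have hz2 := ENNReal.add_ne_top.mp hz'
  have hz3 := ENNReal.add_ne_top.mp hz2.2
  have hac : κ i z ≪ γ := (klDiv_ne_top_iff.mp hz3.1).1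
  have hEf : ∀ᵐ x ∂(κ i z), leafEnergy T κ i z x ≠ ∞ :=
    (ae_lt_top hE hz3.2).mono fun x hx => hx.ne
  have h0 := partition_ne_zero hE hac hEf
  have hprob := isProbabilityMeasure_gibbsTilt h0
  rw [freeEnergy_update hT hκ, e1, leafKernel_apply hT hκ i h0,
    klDiv_gibbsTilt_add_lintegral hE h0, klDiv_add_lintegral_eq hE hac hEf] at hle
  rw [klDiv_add_lintegral_eq hE hac hEf] at e1
  refine ⟨h0, ?_, ?_⟩
  · rw [← klDiv_eq_zero_iff]
    refine le_antisymm ?_ bot_le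
    have := ENNReal.le_of_add_le_add_left hz2.1 hle
    exact ENNReal.le_of_add_le_add_right ENNReal.ofReal_ne_top (by simpa using this)
  · rw [e1]
    exact le_add_self.trans le_add_self

theorem IsMinimizer.pi_le (h : IsMinimizer γ T p κ) (hT : Measurable T)
    (hfin : ∀ z, ∫⁻ y, T (z, y) ∂(Measure.pi fun _ => γ) ≠ ∞) :
    ∀ᵐ z ∂γ, (Measure.pi fun j => κ j z) ≤
      ENNReal.ofReal (Real.exp (freeEnergy γ T κ z).toReal) ^ (n + 1) •
        Measure.pi fun _ : Fin (n + 1) => γ := by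
  filter_upwards [ae_all_iff.mpr fun i => h.leaf hT hfin i, h.freeEnergy_ae_ne_top hT hfin]
    with z hz hF
  have hκ := h.markov
  have hE : ∀ i, Measurable (leafEnergy T κ i z) := fun i =>
    (measurable_leafEnergy hT hκ i).comp measurable_prodMk_left
  have e : ∀ i, κ i z = γ.withDensity fun x =>
      (partition γ (leafEnergy T κ i z))⁻¹ * boltz (leafEnergy T κ i z x) := fun i => by
    rw [← gibbsTilt_eq_withDensity (hE i)]
    exact (hz i).2.1
  have hsf : ∀ i, SigmaFinite (γ.withDensity fun x =>
      (partition γ (leafEnergy T κ i z))⁻¹ * boltz (leafEnergy T κ i z x)) := fun i => by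
    rw [← e i]
    infer_instance
  simp_rw [e]
  rw [pi_withDensity _ _ fun i => (measurable_boltz_comp (hE i)).const_mul _,
    ← withDensity_const]
  refine withDensity_mono (ae_of_all _ fun y => ?_)
  refine (Finset.prod_le_prod' (g := fun _ =>
    ENNReal.ofReal (Real.exp (freeEnergy γ T κ z).toReal)) fun i _ => ?_).trans (by simp)
  set N := partition γ (leafEnergy T κ i z)
  have hN : 0 < N.toReal := ENNReal.toReal_pos (hz i).1 partition_ne_top
  have hb : N⁻¹ ≤ ENNReal.ofReal (Real.exp (freeEnergy γ T κ z).toReal) := by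
    have hN' : N⁻¹ = ENNReal.ofReal N.toReal⁻¹ := by
      rw [ENNReal.ofReal_inv_of_pos hN, ENNReal.ofReal_toReal partition_ne_top]
    rw [hN']
    refine ENNReal.ofReal_le_ofReal ?_
    have := (ENNReal.ofReal_le_iff_le_toReal hF).mp (hz i).2.2
    rw [← Real.exp_log (inv_pos.mpr hN), Real.log_inv]
    exact Real.exp_le_exp.mpr this
  calc _ ≤ N⁻¹ * 1 := mul_le_mul_right (boltz_le_one _) _
    _ ≤ _ := by rwa [mul_one]

end

theorem KL_eq_klDiv {E : Type*} [MeasurableSpace E] (μ π : Measure E) [IsProbabilityMeasure μ]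
    [IsProbabilityMeasure π] : KL μ π = klDiv μ π := by
  unfold KL
  split_ifs with h
  · rw [klDiv_of_ac_of_integrable h.1 h.2]
    simp [llr]
  · by_cases hac : μ ≪ π
    · rw [klDiv_of_not_integrable fun hi => h ⟨hac, hi⟩]
    · rw [klDiv_of_not_ac hac]

theorem starMeasure_eq_compProd {k : ℕ} (p : Measure ℝ) [IsProbabilityMeasure p]
    (κ : Fin k → Kernel ℝ ℝ) (hκ : ∀ j, IsMarkovKernel (κ j)) :
    starMeasure p κ = p ⊗ₘ piKernel κ hκ := by
  rw [Measure.compProd_eq_comp_prod, starMeasure]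
  congr 1
  ext1 z
  rw [Kernel.prod_apply]
  rfl

theorem isStar_starMeasure {k : ℕ} (p : Measure ℝ) [IsProbabilityMeasure p]
    (κ : Fin k → Kernel ℝ ℝ) (hκ : ∀ j, IsMarkovKernel (κ j)) : IsStar (starMeasure p κ) := by
  refine ⟨?_, p, κ, inferInstance, hκ, rfl⟩
  rw [starMeasure_eq_compProd p κ hκ]
  infer_instance

theorem sqNorm_nonneg {k : ℕ} (v : ℝ × (Fin k → ℝ)) : 0 ≤ sqNorm v := by
  unfold sqNorm
  positivity

theorem norm_sq_le_sqNorm {k : ℕ} (v : ℝ × (Fin k → ℝ)) : ‖v‖ ^ 2 ≤ sqNorm v := by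
  have h : ‖v‖ ≤ √(sqNorm v) := by
    refine norm_prod_le_iff.mpr ⟨?_, ?_⟩
    · refine Real.le_sqrt_of_sq_le ?_
      rw [Real.norm_eq_abs, sq_abs, sqNorm]
      have : 0 ≤ ∑ i, v.2 i ^ 2 := by positivity
      linarith
    · refine (pi_norm_le_iff_of_nonneg (Real.sqrt_nonneg _)).mpr fun i => Real.le_sqrt_of_sq_le ?_
      rw [Real.norm_eq_abs, sq_abs, sqNorm]
      have := Finset.single_le_sum (f := fun i => v.2 i ^ 2) (fun i _ => sq_nonneg _)
        (Finset.mem_univ i)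
      have h2 := sq_nonneg v.1
      linarith
  calc ‖v‖ ^ 2 ≤ √(sqNorm v) ^ 2 := by gcongr
    _ = sqNorm v := Real.sq_sqrt (sqNorm_nonneg v)

theorem continuous_sqNorm {k : ℕ} : Continuous (sqNorm : ℝ × (Fin k → ℝ) → ℝ) := by
  unfold sqNorm
  fun_prop

/-- A differentiable strongly convex function dominates a quadratic. -/
theorem exists_quadratic_le {k : ℕ} {V : ℝ × (Fin k → ℝ) → ℝ} {α : ℝ}
    (h : StrongConvexWith α V) (hα : 0 < α) (hV : DifferentiableAt ℝ V 0) :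
    ∃ C : ℝ, ∀ x, α / 4 * sqNorm x ≤ V x + C := by
  set L := fderiv ℝ V 0
  refine ⟨‖L‖ ^ 2 / α - V 0, fun x => ?_⟩
  have hd : HasDerivAt (fun t : ℝ => V (t • x)) (L x) 0 := by
    have h1 : HasDerivAt (fun t : ℝ => t • x) x 0 := by
      simpa using (hasDerivAt_id (0 : ℝ)).smul_const x
    have h2 : HasFDerivAt V L ((0 : ℝ) • x) := by
      rw [zero_smul]
      exact hV.hasFDerivAt
    exact h2.comp_hasDerivAt 0 h1
  have key : L x ≤ V x - V 0 - α / 2 * sqNorm x := by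
    have hlim : Filter.Tendsto (fun t : ℝ => V x - V 0 - α / 2 * (1 - t) * sqNorm x)
        (nhdsWithin 0 (Set.Ioi 0)) (nhds (V x - V 0 - α / 2 * sqNorm x)) := by
      have : Continuous fun t : ℝ => V x - V 0 - α / 2 * (1 - t) * sqNorm x := by fun_prop
      have := this.tendsto 0
      simp only [sub_zero, mul_one] at this
      exact this.mono_left nhdsWithin_le_nhds
    refine le_of_tendsto_of_tendsto hd.tendsto_slope_zero_right hlim ?_
    filter_upwards [Ioc_mem_nhdsGT (zero_lt_one : (0 : ℝ) < 1)] with t ht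
    have := h 0 x t ⟨ht.1.le, ht.2⟩
    have hs : sqNorm (0 - x) = sqNorm x := by simp [sqNorm]
    rw [hs, smul_zero, zero_add] at this
    simp only [zero_add, zero_smul, smul_eq_mul]
    rw [inv_mul_le_iff₀ ht.1]
    linarith
  have h1 : -(‖L‖ * ‖x‖) ≤ L x := (abs_le.mp (L.le_opNorm x)).1
  have h2 := norm_sq_le_sqNorm x
  have h3 : ‖L‖ * ‖x‖ ≤ ‖L‖ ^ 2 / α + α / 4 * ‖x‖ ^ 2 := by
    have h4 : 0 ≤ (‖L‖ - α / 2 * ‖x‖) ^ 2 / α := by positivity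
    have h5 : (‖L‖ - α / 2 * ‖x‖) ^ 2 / α =
        ‖L‖ ^ 2 / α - ‖L‖ * ‖x‖ + α / 4 * ‖x‖ ^ 2 := by
      field_simp
      ring
    linarith
  have h6 : α / 4 * ‖x‖ ^ 2 ≤ α / 4 * sqNorm x := by gcongr
  linarith

/-- The centered Gaussian with density proportional to `exp (-a x²)`. -/
noncomputable def gaussianRef (a : ℝ) : Measure ℝ := gaussianReal 0 (1 / (2 * a)).toNNReal

instance (a : ℝ) : IsProbabilityMeasure (gaussianRef a) := by
  unfold gaussianRef
  infer_instance

theorem exists_gaussianRef_eq {a : ℝ} (ha : 0 < a) : ∃ c : ℝ, 0 < c ∧ gaussianRef a =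
    volume.withDensity fun x => ENNReal.ofReal (c * Real.exp (-(a * x ^ 2))) := by
  set v := (1 / (2 * a)).toNNReal with hv
  have hv' : (v : ℝ) = 1 / (2 * a) := Real.coe_toNNReal _ (by positivity)
  have hv0 : v ≠ 0 := by
    intro h
    rw [h] at hv'
    have : (0 : ℝ) < 1 / (2 * a) := by positivity
    simp at hv'
    exact ha.ne' hv'
  refine ⟨(√(2 * Real.pi * v))⁻¹, ?_, ?_⟩
  · rw [hv']
    positivity
  · rw [gaussianRef, gaussianReal_of_var_ne_zero _ hv0]
    congr 1
    ext1 x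
    rw [gaussianPDF, gaussianPDFReal]
    congr 3
    rw [hv']
    field_simp
    ring

theorem gaussianRef_absolutelyContinuous {a : ℝ} (ha : 0 < a) : gaussianRef a ≪ volume := by
  obtain ⟨c, -, h⟩ := exists_gaussianRef_eq ha
  rw [h]
  exact withDensity_absolutelyContinuous _ _

theorem absolutelyContinuous_gaussianRef {a : ℝ} (ha : 0 < a) : volume ≪ gaussianRef a := by
  obtain ⟨c, hc, h⟩ := exists_gaussianRef_eq ha
  rw [h]
  refine withDensity_absolutelyContinuous' (by fun_prop) (ae_of_all _ fun x => ?_)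
  rw [Ne, ENNReal.ofReal_eq_zero, not_le]
  positivity

theorem lintegral_exp_sq_gaussianRef_ne_top {a b : ℝ} (ha : 0 < a) (hb : b < a) :
    ∫⁻ x, ENNReal.ofReal (Real.exp (b * x ^ 2)) ∂(gaussianRef a) ≠ ∞ := by
  obtain ⟨c, hc, h⟩ := exists_gaussianRef_eq ha
  rw [h, lintegral_withDensity_eq_lintegral_mul _ (by fun_prop) (by fun_prop)]
  have hi := (integrable_exp_neg_mul_sq (sub_pos.mpr hb)).const_mul c
  refine ne_of_eq_of_ne (lintegral_congr fun x => ?_) hi.lintegral_lt_top.ne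
  rw [Pi.mul_apply, ← ENNReal.ofReal_mul (by positivity), mul_assoc, ← Real.exp_add]
  congr 3
  ring

theorem pi_gaussianRef_eq {k : ℕ} {a c : ℝ} (hc : 0 < c) (h : gaussianRef a =
    volume.withDensity fun x => ENNReal.ofReal (c * Real.exp (-(a * x ^ 2)))) :
    (Measure.pi fun _ : Fin k => gaussianRef a) = volume.withDensity fun y =>
      ENNReal.ofReal (c ^ k * Real.exp (-(a * ∑ i, y i ^ 2))) := by
  have hsf : SigmaFinite (volume.withDensity fun x : ℝ =>
      ENNReal.ofReal (c * Real.exp (-(a * x ^ 2)))) := by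
    rw [← h]
    infer_instance
  rw [h, pi_withDensity _ _ fun _ => by fun_prop]
  congr 1
  ext1 y
  rw [← ENNReal.ofReal_prod_of_nonneg fun i _ => by positivity, Finset.prod_mul_distrib,
    ← Real.exp_sum]
  simp [Finset.mul_sum]

theorem lintegral_exp_sq_pi_gaussianRef_ne_top {k : ℕ} {a b : ℝ} (ha : 0 < a) (hb : b < a) :
    ∫⁻ y, ENNReal.ofReal (Real.exp (b * ∑ i, y i ^ 2))
      ∂(Measure.pi fun _ : Fin k => gaussianRef a) ≠ ∞ := by
  have : ∀ y : Fin k → ℝ, ENNReal.ofReal (Real.exp (b * ∑ i, y i ^ 2)) =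
      ∏ i, ENNReal.ofReal (Real.exp (b * y i ^ 2)) := fun y => by
    rw [← ENNReal.ofReal_prod_of_nonneg fun i _ => by positivity, ← Real.exp_sum, Finset.mul_sum]
  simp_rw [this]
  rw [lintegral_pi_prod _ (fun _ x => ENNReal.ofReal (Real.exp (b * x ^ 2))) fun _ => by fun_prop]
  exact ENNReal.prod_ne_top fun i _ => lintegral_exp_sq_gaussianRef_ne_top ha hb

theorem prod_gaussianRef_eq {k : ℕ} {a : ℝ} (ha : 0 < a) : ∃ c : ℝ, 0 < c ∧
    (gaussianRef a).prod (Measure.pi fun _ : Fin k => gaussianRef a) = volume.withDensity fun z =>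
      ENNReal.ofReal (c * Real.exp (-(a * sqNorm z))) := by
  obtain ⟨c, hc, h⟩ := exists_gaussianRef_eq ha
  refine ⟨c * c ^ k, by positivity, ?_⟩
  have h' := h
  rw [pi_gaussianRef_eq hc h, h, prod_withDensity (by fun_prop) (by fun_prop),
    ← Measure.volume_eq_prod]
  congr 1
  ext1 z
  rw [← ENNReal.ofReal_mul (by positivity), sqNorm, mul_add, neg_add, Real.exp_add]
  congr 1
  ring

theorem inv_univ_smul_const_smul {X : Type*} [MeasurableSpace X] (μ : Measure X) {K : ℝ≥0∞}
    (h0 : K ≠ 0) (ht : K ≠ ∞) : ((K • μ) Set.univ)⁻¹ • (K • μ) = (μ Set.univ)⁻¹ • μ := by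
  rw [Measure.smul_apply, smul_smul, smul_eq_mul, ENNReal.mul_inv (Or.inl h0) (Or.inl ht), mul_comm,
    ← mul_assoc, ENNReal.mul_inv_cancel h0 ht, one_mul]

/-- The excess of `V + C` over the quadratic `a ‖·‖²`. -/
noncomputable def excess {k : ℕ} (V : ℝ × (Fin k → ℝ) → ℝ) (a C : ℝ) (z : ℝ × (Fin k → ℝ)) :
    ℝ≥0∞ := ENNReal.ofReal (V z + C - a * sqNorm z)

theorem measurable_excess {k : ℕ} {V : ℝ × (Fin k → ℝ) → ℝ} {a C : ℝ} (hV : Continuous V) :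
    Measurable (excess V a C) :=
  ((hV.add continuous_const).sub (continuous_sqNorm.const_mul a)).measurable.ennreal_ofReal

theorem gibbs_eq_gibbsTilt {k : ℕ} {V : ℝ × (Fin k → ℝ) → ℝ} {a C : ℝ} (ha : 0 < a)
    (hV : Continuous V) (hC : ∀ x, a * sqNorm x ≤ V x + C) :
    gibbs V = gibbsTilt ((gaussianRef a).prod (Measure.pi fun _ : Fin k => gaussianRef a))
      (excess V a C) := by
  obtain ⟨c, hc, h⟩ := prod_gaussianRef_eq (k := k) ha
  have hK : 0 < c * Real.exp (-C) := by positivity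
  have key : ((gaussianRef a).prod (Measure.pi fun _ : Fin k => gaussianRef a)).withDensity
      (fun z => boltz (excess V a C z)) = ENNReal.ofReal (c * Real.exp (-C)) •
        volume.withDensity fun z => ENNReal.ofReal (Real.exp (-V z)) := by
    have hm1 : Measurable fun z : ℝ × (Fin k → ℝ) =>
        ENNReal.ofReal (c * Real.exp (-(a * sqNorm z))) :=
      ((continuous_sqNorm.const_mul a).neg.rexp.const_mul c).measurable.ennreal_ofReal
    have hm2 : Measurable fun z => ENNReal.ofReal (Real.exp (-V z)) :=
      hV.neg.rexp.measurable.ennreal_ofReal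
    rw [h, ← withDensity_mul _ hm1 (measurable_boltz_comp (measurable_excess hV)),
      ← withDensity_smul _ hm2]
    congr 1
    ext1 z
    rw [Pi.mul_apply, excess, boltz_ofReal (by linarith [hC z]), Pi.smul_apply, smul_eq_mul,
      ← ENNReal.ofReal_mul (by positivity), ← ENNReal.ofReal_mul (by positivity), mul_assoc,
      mul_assoc, ← Real.exp_add, ← Real.exp_add]
    congr 3
    ring
  have hpart : partition ((gaussianRef a).prod (Measure.pi fun _ : Fin k => gaussianRef a))
      (excess V a C) =
      (((gaussianRef a).prod (Measure.pi fun _ : Fin k => gaussianRef a)).withDensity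
      (fun z => boltz (excess V a C z))) Set.univ := by
    rw [withDensity_apply _ MeasurableSet.univ, setLIntegral_univ, partition]
  rw [gibbsTilt, hpart, key, inv_univ_smul_const_smul _ (by simpa using hK) ENNReal.ofReal_ne_top,
    gibbs]

theorem exists_excess_le {k : ℕ} {V : ℝ × (Fin k → ℝ) → ℝ} {a b : ℝ} (C : ℝ) (hgr : GrowthCond V)
    (ha : 0 < a) (hb : 0 < b) : ∃ K : ℝ, 0 < K ∧ ∀ z y, excess V a C (z, y) ≤
      ENNReal.ofReal (K * Real.exp (b * z ^ 2)) *
        ENNReal.ofReal (Real.exp (b * ∑ i, y i ^ 2)) := by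
  obtain ⟨c₁, hc₁, h⟩ := hgr b hb
  refine ⟨c₁ + |C|, by positivity, fun z y => ?_⟩
  rw [← ENNReal.ofReal_mul (by positivity), mul_assoc, ← Real.exp_add, ← mul_add]
  refine ENNReal.ofReal_le_ofReal ?_
  have h1 := h (z, y)
  have h2 := sqNorm_nonneg (z, y)
  have h3 : 1 ≤ Real.exp (b * sqNorm (z, y)) := Real.one_le_exp (by positivity)
  have h4 : 0 ≤ a * sqNorm (z, y) := by positivity
  have h5 : |C| * 1 ≤ |C| * Real.exp (b * sqNorm (z, y)) := by gcongr
  have h6 := le_abs_self (V (z, y))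
  have h7 := le_abs_self C
  have h8 : sqNorm (z, y) = z ^ 2 + ∑ i, y i ^ 2 := rfl
  rw [← h8, add_mul]
  linarith

section
variable {k : ℕ} {V : ℝ × (Fin k → ℝ) → ℝ} {a C : ℝ}

/-- The Gaussian exponential moment `∫ exp ((a / 2) ∑ yᵢ²) dΓ`. -/
noncomputable def gaussMoment (k : ℕ) (a : ℝ) : ℝ≥0∞ :=
  ∫⁻ y, ENNReal.ofReal (Real.exp (a / 2 * ∑ i, y i ^ 2))
    ∂(Measure.pi fun _ : Fin k => gaussianRef a)

theorem gaussMoment_ne_top (ha : 0 < a) : gaussMoment k a ≠ ∞ :=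
  lintegral_exp_sq_pi_gaussianRef_ne_top ha (by linarith)

theorem exists_lintegral_excess_le (C : ℝ) (hgr : GrowthCond V) (ha : 0 < a) :
    ∃ K : ℝ, 0 < K ∧ ∀ z, ∫⁻ y, excess V a C (z, y) ∂(Measure.pi fun _ => gaussianRef a) ≤
      ENNReal.ofReal (K * Real.exp (a / 2 * z ^ 2)) * gaussMoment k a := by
  obtain ⟨K, hK, h⟩ := exists_excess_le C hgr ha (half_pos ha)
  refine ⟨K, hK, fun z => (lintegral_mono fun y => h z y).trans ?_⟩
  rw [lintegral_const_mul _ (by fun_prop)]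
  rfl

theorem lintegral_excess_ne_top (C : ℝ) (hgr : GrowthCond V) (ha : 0 < a) (z : ℝ) :
    ∫⁻ y, excess V a C (z, y) ∂(Measure.pi fun _ => gaussianRef a) ≠ ∞ := by
  obtain ⟨K, -, h⟩ := exists_lintegral_excess_le C hgr ha
  exact ((h z).trans_lt (ENNReal.mul_lt_top ENNReal.ofReal_lt_top
    (gaussMoment_ne_top ha).lt_top)).ne

theorem isMinimizer_excess (ha : 0 < a) (hV : Continuous V) (hC : ∀ x, a * sqNorm x ≤ V x + C)
    (hgr : GrowthCond V) {π : Measure (ℝ × (Fin k → ℝ))} [IsProbabilityMeasure π]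
    (hπ : π = gibbs V) {p : Measure ℝ} {κ : Fin k → Kernel ℝ ℝ} (hp : IsProbabilityMeasure p)
    (hκ : ∀ j, IsMarkovKernel (κ j))
    (hmin : ∀ μ, IsStar μ → KL (starMeasure p κ) π ≤ KL μ π) :
    IsMinimizer (gaussianRef a) (excess V a C) p κ := by
  have hT := measurable_excess (a := a) (C := C) hV
  have key : ∀ (p' : Measure ℝ) (κ' : Fin k → Kernel ℝ ℝ), IsProbabilityMeasure p' →
      (∀ j, IsMarkovKernel (κ' j)) → klDiv p (gaussianRef a) +
        ∫⁻ z, freeEnergy (gaussianRef a) (excess V a C) κ z ∂p ≤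
      klDiv p' (gaussianRef a) +
        ∫⁻ z, freeEnergy (gaussianRef a) (excess V a C) κ' z ∂p' := by
    intro p' κ' hp' hκ'
    have h := hmin _ (isStar_starMeasure p' κ' hκ')
    rw [starMeasure_eq_compProd p κ hκ, starMeasure_eq_compProd p' κ' hκ', KL_eq_klDiv,
      KL_eq_klDiv, hπ, gibbs_eq_gibbsTilt ha hV hC] at h
    have hfin : ∀ x, excess V a C x ≠ ∞ := fun x => ENNReal.ofReal_ne_top
    rw [← klDiv_compProd_add_lintegral hT hκ, ← klDiv_compProd_add_lintegral hT hκ',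
      klDiv_add_lintegral_eq_of_ne_top hT hfin, klDiv_add_lintegral_eq_of_ne_top hT hfin]
    gcongr
  refine ⟨hp, hκ, ?_, key⟩
  refine ((key (gaussianRef a) (fun _ => Kernel.const ℝ (gaussianRef a)) inferInstance
    fun _ => inferInstance).trans_lt ?_).ne
  obtain ⟨K, hK, h⟩ := exists_lintegral_excess_le C hgr ha
  simp_rw [klDiv_self, zero_add, freeEnergy_const]
  refine (lintegral_mono h).trans_lt ?_
  rw [lintegral_mul_const _ (by fun_prop)]
  refine ENNReal.mul_lt_top ?_ (gaussMoment_ne_top ha).lt_top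
  simp_rw [ENNReal.ofReal_mul hK.le]
  rw [lintegral_const_mul _ (by fun_prop)]
  exact ENNReal.mul_lt_top ENNReal.ofReal_lt_top
    (lintegral_exp_sq_gaussianRef_ne_top ha (by linarith)).lt_top

end

section
variable {n : ℕ} {V : ℝ × (Fin (n + 1) → ℝ) → ℝ} {a C : ℝ} {p : Measure ℝ}
  {κ : Fin (n + 1) → Kernel ℝ ℝ}

/-- Along a minimizer the free energy and an exponential moment of the leaves are locally bounded
in the position of the root. -/
theorem IsMinimizer.exists_bounds (h : IsMinimizer (gaussianRef a) (excess V a C) p κ)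
    (ha : 0 < a) (hV : Continuous V) (hgr : GrowthCond V) :
    ∃ B D : ℝ → ℝ, Continuous B ∧ Continuous D ∧ ∀ᵐ z ∂(volume : Measure ℝ),
      freeEnergy (gaussianRef a) (excess V a C) κ z ≤ ENNReal.ofReal (B z) ∧
      ∫⁻ y, ENNReal.ofReal (Real.exp (a / 2 * ∑ i, y i ^ 2)) ∂(Measure.pi fun j => κ j z) ≤
        ENNReal.ofReal (D z) := by
  have hT := measurable_excess (a := a) (C := C) hV
  have hfin := lintegral_excess_ne_top C hgr ha
  obtain ⟨K, hK, hb⟩ := exists_lintegral_excess_le C hgr ha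
  set M := (gaussMoment (n + 1) a).toReal
  have hM : gaussMoment (n + 1) a = ENNReal.ofReal M :=
    (ENNReal.ofReal_toReal (gaussMoment_ne_top ha)).symm
  have hM0 : 0 ≤ M := ENNReal.toReal_nonneg
  set B : ℝ → ℝ := fun z => K * Real.exp (a / 2 * z ^ 2) * M with hB
  refine ⟨B, fun z => Real.exp (B z) ^ (n + 1) * M, by fun_prop, by fun_prop,
    (absolutelyContinuous_gaussianRef ha).ae_le ?_⟩
  filter_upwards [h.freeEnergy_ae_le hT hfin (κ' := fun _ => Kernel.const ℝ (gaussianRef a))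
    (fun _ => inferInstance), h.pi_le hT hfin] with z h1 h2
  have h3 : freeEnergy (gaussianRef a) (excess V a C) κ z ≤ ENNReal.ofReal (B z) := by
    refine h1.trans ?_
    rw [freeEnergy_const, ENNReal.ofReal_mul (by positivity), ← hM]
    exact hb z
  have hB0 : 0 ≤ B z := by positivity
  refine ⟨h3, (lintegral_mono' h2 le_rfl).trans ?_⟩
  rw [lintegral_smul_measure, smul_eq_mul, ENNReal.ofReal_mul (by positivity), ← hM,
    ENNReal.ofReal_pow (by positivity), gaussMoment]
  gcongr
  exact ENNReal.toReal_le_of_le_ofReal hB0 h3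

theorem exists_abs_update_le (hgr : GrowthCond V) {b : ℝ} (hb : 0 < b) : ∃ c₁ : ℝ,
    0 < c₁ ∧ ∀ z i y x, |V (z, Function.update y i x)| ≤
      c₁ * Real.exp (b * (z ^ 2 + x ^ 2)) * Real.exp (b * ∑ j, y j ^ 2) := by
  obtain ⟨c₁, hc₁, h⟩ := hgr b hb
  refine ⟨c₁, hc₁, fun z i y x => (h _).trans ?_⟩
  rw [mul_assoc, ← Real.exp_add, ← mul_add]
  gcongr
  simp only [sqNorm]
  rw [Fin.sum_univ_succAbove _ i, Fin.sum_univ_succAbove _ i]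
  simp only [Function.update_self, ne_eq, Fin.succAbove_ne, not_false_eq_true,
    Function.update_of_ne]
  have := sq_nonneg (y i)
  linarith

theorem sqNorm_update (z : ℝ) (y : Fin (n + 1) → ℝ) (i : Fin (n + 1)) (x : ℝ) :
    sqNorm (z, Function.update y i x) = x ^ 2 + sqNorm (z, Function.update y i 0) := by
  simp only [sqNorm]
  rw [Fin.sum_univ_succAbove _ i, Fin.sum_univ_succAbove _ i]
  simp only [Function.update_self, ne_eq, Fin.succAbove_ne, not_false_eq_true,
    Function.update_of_ne]
  ring

theorem IsMinimizer.leaf_eq (h : IsMinimizer (gaussianRef a) (excess V a C) p κ)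
    (ha : 0 < a) (hV : Continuous V) (hC : ∀ x, a * sqNorm x ≤ V x + C)
    (hgr : GrowthCond V) (i : Fin (n + 1)) :
    ∀ᵐ z ∂(volume : Measure ℝ), ∃ c : ℝ, 0 < c ∧
      κ i z = volume.withDensity fun x => ENNReal.ofReal (c * Real.exp
        (-(∫ y, V (z, Function.update y i x) ∂(Measure.pi fun j => κ j z)))) := by
  have hκ := h.markov
  have hT := measurable_excess (a := a) (C := C) hV
  have hfin := lintegral_excess_ne_top C hgr ha
  obtain ⟨B, D, -, -, hBD⟩ := h.exists_bounds ha hV hgr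
  obtain ⟨c₁, hc₁, hup⟩ := exists_abs_update_le hgr (half_pos ha)
  obtain ⟨c, hc, hγ⟩ := exists_gaussianRef_eq ha
  filter_upwards [hBD, (absolutelyContinuous_gaussianRef ha).ae_le (h.leaf hT hfin i)]
    with z hz hl
  obtain ⟨h0, hleaf, -⟩ := hl
  set Q := Measure.pi fun j => κ j z
  have hexp : Integrable (fun y : Fin (n + 1) → ℝ => Real.exp (a / 2 * ∑ j, y j ^ 2)) Q := by
    refine ⟨Continuous.aestronglyMeasurable (by fun_prop), ?_⟩
    rw [hasFiniteIntegral_iff_ofReal (ae_of_all _ fun y => (Real.exp_pos _).le)]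
    exact hz.2.trans_lt ENNReal.ofReal_lt_top
  have hupd : ∀ x, Continuous fun y : Fin (n + 1) → ℝ => (z, Function.update y i x) := fun x => by
    fun_prop
  have hVi : ∀ x, Integrable (fun y => V (z, Function.update y i x)) Q := fun x =>
    (hexp.const_mul (c₁ * Real.exp (a / 2 * (z ^ 2 + x ^ 2)))).mono'
      (hV.comp (hupd x)).aestronglyMeasurable (ae_of_all _ fun y => hup z i y x)
  have hRi : Integrable (fun y => sqNorm (z, Function.update y i 0)) Q := by
    refine ((hVi 0).add (integrable_const C)).const_mul a⁻¹ |>.mono'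
      (continuous_sqNorm.comp (hupd 0)).aestronglyMeasurable (ae_of_all _ fun y => ?_)
    rw [Real.norm_eq_abs, abs_of_nonneg (sqNorm_nonneg _), le_inv_mul_iff₀ ha]
    exact hC _
  set R := ∫ y, sqNorm (z, Function.update y i 0) ∂Q
  have hE : ∀ x, boltz (leafEnergy (excess V a C) κ i z x) = ENNReal.ofReal (Real.exp
      (-((∫ y, V (z, Function.update y i x) ∂Q) + C - a * (x ^ 2 + R)))) := by
    intro x
    have hs : Integrable (fun y => sqNorm (z, Function.update y i x)) Q := by
      simp_rw [sqNorm_update z _ i x]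
      exact (integrable_const _).add hRi
    have hi : Integrable (fun y => V (z, Function.update y i x) + C -
        a * sqNorm (z, Function.update y i x)) Q :=
      ((hVi x).add (integrable_const C)).sub (hs.const_mul a)
    have hnn : ∀ y, 0 ≤ V (z, Function.update y i x) + C -
        a * sqNorm (z, Function.update y i x) := fun y => by
      linarith [hC (z, Function.update y i x)]
    have hI : ∫ y, V (z, Function.update y i x) + C - a * sqNorm (z, Function.update y i x) ∂Q =
        (∫ y, V (z, Function.update y i x) ∂Q) + C - a * (x ^ 2 + R) := by
      have hVC : Integrable (fun y => V (z, Function.update y i x) + C) Q :=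
        (hVi x).add (integrable_const C)
      rw [integral_sub hVC (hs.const_mul a), integral_add (hVi x) (integrable_const C),
        integral_const_mul]
      simp_rw [sqNorm_update z _ i x]
      rw [integral_add (integrable_const _) hRi]
      simp [R]
    rw [leafEnergy, ← hI, ← boltz_ofReal (integral_nonneg hnn),
      ofReal_integral_eq_lintegral_ofReal hi (ae_of_all _ hnn)]
    rfl
  set N := (partition (gaussianRef a) (leafEnergy (excess V a C) κ i z)).toReal with hN
  have hN0 : 0 < N := ENNReal.toReal_pos h0 partition_ne_top
  have hNinv : (partition (gaussianRef a) (leafEnergy (excess V a C) κ i z))⁻¹ =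
      ENNReal.ofReal N⁻¹ := by
    rw [ENNReal.ofReal_inv_of_pos hN0, ENNReal.ofReal_toReal partition_ne_top]
  refine ⟨c * N⁻¹ * Real.exp (a * R - C), by positivity, ?_⟩
  have hEm : Measurable (leafEnergy (excess V a C) κ i z) :=
    (measurable_leafEnergy hT hκ i).comp measurable_prodMk_left
  rw [hleaf, gibbsTilt_eq_withDensity hEm, hNinv]
  nth_rw 1 [hγ]
  rw [← withDensity_mul _ (by fun_prop) ((measurable_boltz_comp hEm).const_mul _)]
  congr 1
  ext1 x
  rw [Pi.mul_apply, hE, ← ENNReal.ofReal_mul (by positivity), ← ENNReal.ofReal_mul (by positivity)]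
  congr 1
  rw [show c * Real.exp (-(a * x ^ 2)) * (N⁻¹ * Real.exp (-((∫ y, V (z, Function.update y i x) ∂Q)
    + C - a * (x ^ 2 + R)))) = c * N⁻¹ * (Real.exp (-(a * x ^ 2)) * Real.exp
    (-((∫ y, V (z, Function.update y i x) ∂Q) + C - a * (x ^ 2 + R)))) by ring, ← Real.exp_add,
    mul_assoc (c * N⁻¹), ← Real.exp_add]
  congr 2
  ring

end

/-- Differentiation at `0` under the integral sign, assuming only a linear bound at `0`. -/
theorem hasDerivAt_integral_of_linear_bound {X : Type*} [MeasurableSpace X] {μ : Measure X}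
    {F : ℝ → X → ℝ} {F' bound : X → ℝ} (hF : ∀ h, AEStronglyMeasurable (F h) μ)
    (hb : ∀ᵐ x ∂μ, ∀ h, |h| ≤ 1 → |F h x| ≤ bound x * |h|) (hbi : Integrable bound μ)
    (hd : ∀ᵐ x ∂μ, HasDerivAt (fun h => F h x) (F' x) 0) :
    Integrable F' μ ∧ HasDerivAt (fun h => ∫ x, F h x ∂μ) (∫ x, F' x ∂μ) 0 := by
  have h0 : ∀ᵐ x ∂μ, F 0 x = 0 := by
    filter_upwards [hb] with x hx
    simpa using hx 0 (by simp)
  have hlim : ∀ᵐ x ∂μ, Filter.Tendsto (fun h => h⁻¹ * F h x) (nhdsWithin 0 {0}ᶜ)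
      (nhds (F' x)) := by
    filter_upwards [hd, h0] with x hx hx0
    simpa [hx0] using hasDerivAt_iff_tendsto_slope_zero.mp hx
  have hle : ∀ᶠ h : ℝ in nhdsWithin 0 {0}ᶜ, ∀ᵐ x ∂μ, ‖h⁻¹ * F h x‖ ≤ bound x := by
    have hball : ∀ᶠ h : ℝ in nhdsWithin 0 {0}ᶜ, |h| ≤ 1 := by
      refine nhdsWithin_le_nhds ?_
      filter_upwards [Metric.closedBall_mem_nhds (0 : ℝ) zero_lt_one] with h hh
      simpa using hh
    filter_upwards [hball, self_mem_nhdsWithin] with h hh hne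
    filter_upwards [hb] with x hx
    have hpos : 0 < |h| := abs_pos.mpr hne
    rw [Real.norm_eq_abs, abs_mul, abs_inv, inv_mul_le_iff₀ hpos, mul_comm]
    exact hx h hh
  have hbound : ∀ᵐ x ∂μ, ‖F' x‖ ≤ bound x := by
    filter_upwards [hb, hlim] with x hx hl
    refine le_of_tendsto hl.norm ?_
    have hball : ∀ᶠ h : ℝ in nhdsWithin 0 {0}ᶜ, |h| ≤ 1 := by
      refine nhdsWithin_le_nhds ?_
      filter_upwards [Metric.closedBall_mem_nhds (0 : ℝ) zero_lt_one] with h hh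
      simpa using hh
    filter_upwards [hball, self_mem_nhdsWithin] with h hh hne
    have hpos : 0 < |h| := abs_pos.mpr hne
    rw [Real.norm_eq_abs, abs_mul, abs_inv, inv_mul_le_iff₀ hpos, mul_comm]
    exact hx h hh
  have hmeas : AEStronglyMeasurable F' μ :=
    aestronglyMeasurable_of_tendsto_ae (nhdsWithin (0 : ℝ) {0}ᶜ)
      (fun h => (hF h).const_mul h⁻¹) hlim
  refine ⟨hbi.mono' hmeas hbound, ?_⟩
  rw [hasDerivAt_iff_tendsto_slope_zero]
  have := tendsto_integral_filter_of_dominated_convergence bound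
    (Filter.Eventually.of_forall fun h => (hF h).const_mul h⁻¹) hle hbi hlim
  refine this.congr fun h => ?_
  rw [integral_const_mul, zero_add, integral_eq_zero_of_ae h0, sub_zero, smul_eq_mul]

/-- A locally integrable function whose increments are bounded above by a family of functions
that are differentiable at zero increment is a primitive of the derivative. -/
theorem exists_ae_eq_add_intervalIntegral {f g M : ℝ → ℝ} {G : ℝ → ℝ → ℝ}
    (hf : LocallyIntegrable f volume) (hG : ∀ h, AEStronglyMeasurable (G h) volume)
    (hle : ∀ h, ∀ᵐ z, f (z + h) - f z ≤ G h z)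
    (hb : ∀ᵐ z, ∀ h, |h| ≤ 1 → |G h z| ≤ M z * |h|) (hM : Continuous M)
    (hd : ∀ᵐ z, HasDerivAt (fun h => G h z) (g z) 0) :
    ∃ C, ∀ᵐ z, f z = C + ∫ s in (0 : ℝ)..z, g s := by
  have hfi : ∀ x y, IntervalIntegrable f volume x y := fun x y =>
    intervalIntegrable_iff.mpr
      ((hf.integrableOn_isCompact isCompact_uIcc).mono_set Set.uIoc_subset_uIcc)
  have hder : ∀ x y, x ≤ y → IntervalIntegrable g volume x y ∧
      HasDerivAt (fun h => ∫ z in x..y, G h z) (∫ z in x..y, g z) 0 := by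
    intro x y hxy
    simp only [intervalIntegrable_iff_integrableOn_Ioc_of_le hxy,
      intervalIntegral.integral_of_le hxy]
    exact hasDerivAt_integral_of_linear_bound (fun h => (hG h).restrict)
      (ae_restrict_of_ae hb) ((hM.integrableOn_Icc).mono_set Set.Ioc_subset_Icc_self)
      (ae_restrict_of_ae hd)
  have hgi : ∀ x y, IntervalIntegrable g volume x y := fun x y => by
    rcases le_total x y with h | h
    · exact (hder x y h).1
    · exact (hder y x h).1.symm
  have hGi : ∀ x y h, |h| ≤ 1 → IntervalIntegrable (G h) volume x y := by
    intro x y h hh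
    refine ((hM.mul_const |h|).intervalIntegrable x y).mono_fun' (hG h).restrict ?_
    exact ae_restrict_of_ae (hb.mono fun z hz => hz h hh)
  have key : ∀ x y, x ≤ y → HasDerivAt (fun t => ∫ s in x..t, f s) (f x) x →
      HasDerivAt (fun t => ∫ s in y..t, f s) (f y) y → f y = f x + ∫ s in x..y, g s := by
    intro x y hxy hx hy
    have hx' : HasDerivAt (fun h => ∫ s in x..(x + h), f s) (f x) 0 :=
      HasDerivAt.comp_const_add x 0 (by simpa using hx)
    have hy' : HasDerivAt (fun h => ∫ s in y..(y + h), f s) (f y) 0 :=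
      HasDerivAt.comp_const_add y 0 (by simpa using hy)
    have hD := (hder x y hxy).2.sub (hy'.sub hx')
    have hshift : ∀ h, IntervalIntegrable (fun z => f (z + h)) volume x y := fun h => by
      simpa using (hfi (x + h) (y + h)).comp_add_right h
    have heq : ∀ h, (∫ s in y..(y + h), f s) - ∫ s in x..(x + h), f s =
        ∫ z in x..y, (f (z + h) - f z) := by
      intro h
      rw [intervalIntegral.integral_sub (hshift h) (hfi x y),
        intervalIntegral.integral_comp_add_right]
      have e1 := intervalIntegral.integral_add_adjacent_intervals (hfi x (x + h))
        (hfi (x + h) (y + h))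
      have e2 := intervalIntegral.integral_add_adjacent_intervals (hfi x y) (hfi y (y + h))
      linarith
    have hmin : IsLocalMin ((fun h => ∫ z in x..y, G h z) -
        ((fun h => ∫ s in y..(y + h), f s) - fun h => ∫ s in x..(x + h), f s)) 0 := by
      have hball : ∀ᶠ h : ℝ in nhds 0, |h| ≤ 1 := by
        filter_upwards [Metric.closedBall_mem_nhds (0 : ℝ) zero_lt_one] with h hh
        simpa using hh
      filter_upwards [hball] with h hh
      have hz : ∫ z in x..y, G 0 z = 0 := by
        refine intervalIntegral.integral_zero_ae (hb.mono fun z hz _ => ?_)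
        simpa using hz 0 (by simp)
      simp only [Pi.sub_apply, heq, hz, add_zero, intervalIntegral.integral_same, sub_self,
        sub_nonneg]
      exact intervalIntegral.integral_mono_ae hxy ((hshift h).sub (hfi x y)) (hGi x y h hh) (hle h)
    have := hmin.hasDerivAt_eq_zero hD
    linarith
  have hL := LocallyIntegrable.ae_hasDerivAt_integral hf
  obtain ⟨x₀, hx₀⟩ := hL.exists
  refine ⟨f x₀ - ∫ s in (0 : ℝ)..x₀, g s, ?_⟩
  filter_upwards [hL] with y hy
  have e := intervalIntegral.integral_add_adjacent_intervals (hgi 0 x₀) (hgi x₀ y)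
  rcases le_total x₀ y with h | h
  · have := key x₀ y h (hx₀ x₀) (hy y)
    linarith
  · have := key y x₀ h (hy y) (hx₀ x₀)
    rw [intervalIntegral.integral_symm] at this
    linarith

section
variable {k : ℕ} {V : ℝ × (Fin k → ℝ) → ℝ} {a C : ℝ} {Q : Measure (Fin k → ℝ)}

theorem integrable_potential [IsFiniteMeasure Q] (hV : Continuous V) (hgr : GrowthCond V)
    (ha : 0 < a) (hQ : Integrable (fun y : Fin k → ℝ => Real.exp (a * ∑ i, y i ^ 2)) Q)
    (w : ℝ) : Integrable (fun y => V (w, y)) Q := by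
  obtain ⟨c₁, hc₁, h⟩ := hgr a ha
  refine (hQ.const_mul (c₁ * Real.exp (a * w ^ 2))).mono'
    (Continuous.aestronglyMeasurable (by fun_prop)) (ae_of_all _ fun y => (h _).trans_eq ?_)
  rw [mul_assoc, ← Real.exp_add, ← mul_add]
  rfl

theorem integrable_sqNorm_snd [IsFiniteMeasure Q] (ha : 0 < a)
    (hC : ∀ x, a * sqNorm x ≤ V x + C) (hVi : Integrable (fun y => V (0, y)) Q) :
    Integrable (fun y : Fin k → ℝ => ∑ i, y i ^ 2) Q := by
  refine ((hVi.add (integrable_const C)).const_mul a⁻¹).mono'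
    (Continuous.aestronglyMeasurable (by fun_prop)) (ae_of_all _ fun y => ?_)
  rw [Real.norm_eq_abs, abs_of_nonneg (Finset.sum_nonneg fun i _ => sq_nonneg _),
    le_inv_mul_iff₀ ha]
  simpa [sqNorm] using hC (0, y)

theorem lintegral_excess_eq [IsProbabilityMeasure Q] (ha : 0 < a)
    (hC : ∀ x, a * sqNorm x ≤ V x + C) (hVi : ∀ w, Integrable (fun y => V (w, y)) Q) (w : ℝ) :
    ∫⁻ y, excess V a C (w, y) ∂Q = ENNReal.ofReal
      ((∫ y, V (w, y) ∂Q) + C - a * w ^ 2 - a * ∫ y, ∑ i, y i ^ 2 ∂Q) := by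
  have hs := integrable_sqNorm_snd ha hC (hVi 0)
  have h1 : Integrable (fun y => V (w, y) + (C - a * w ^ 2)) Q :=
    (hVi w).add (integrable_const _)
  have e : ∀ y, V (w, y) + C - a * sqNorm (w, y) =
      V (w, y) + (C - a * w ^ 2) - a * ∑ i, y i ^ 2 := fun y => by simp only [sqNorm]; ring
  have hI : ∫ y, (V (w, y) + C - a * sqNorm (w, y)) ∂Q =
      (∫ y, V (w, y) ∂Q) + C - a * w ^ 2 - a * ∫ y, ∑ i, y i ^ 2 ∂Q := by
    simp_rw [e]
    rw [integral_sub h1 (hs.const_mul a), integral_add (hVi w) (integrable_const _),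
      integral_const_mul]
    simp
    ring
  rw [← hI, ofReal_integral_eq_lintegral_ofReal]
  · rfl
  · simp_rw [e]
    exact h1.sub (hs.const_mul a)
  · exact ae_of_all _ fun y => by simpa using hC (w, y)

/-- Replacing the leaf law at a shifted root by the leaf law at the root changes the energy by an
increment of the averaged potential. -/
theorem freeEnergy_sub_le {κ : Fin k → Kernel ℝ ℝ} (hκ : ∀ j, IsMarkovKernel (κ j)) (ha : 0 < a)
    (hC : ∀ x, a * sqNorm x ≤ V x + C) {γ : Measure ℝ} {z h : ℝ}
    (hVi : ∀ w, Integrable (fun y => V (w, y)) (Measure.pi fun j => κ j z))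
    (hfin : freeEnergy γ (excess V a C) κ z ≠ ∞)
    (hle : freeEnergy γ (excess V a C) κ (z + h) ≤
      klDiv (Measure.pi fun j => κ j z) (Measure.pi fun _ => γ) +
        ∫⁻ y, excess V a C (z + h, y) ∂(Measure.pi fun j => κ j z)) :
    ((freeEnergy γ (excess V a C) κ (z + h)).toReal + a * (z + h) ^ 2) -
      ((freeEnergy γ (excess V a C) κ z).toReal + a * z ^ 2) ≤
      ∫ y, (V (z + h, y) - V (z, y)) ∂(Measure.pi fun j => κ j z) := by
  have hk : klDiv (Measure.pi fun j => κ j z) (Measure.pi fun _ => γ) ≠ ∞ := fun e =>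
    hfin (by rw [freeEnergy, e, top_add])
  have hnn : ∀ w, 0 ≤ (∫ y, V (w, y) ∂(Measure.pi fun j => κ j z)) + C - a * w ^ 2 -
      a * ∫ y, ∑ i, y i ^ 2 ∂(Measure.pi fun j => κ j z) := by
    intro w
    have hs := integrable_sqNorm_snd ha hC (hVi 0)
    have := integral_mono (μ := Measure.pi fun j => κ j z)
      (f := fun y => a * (w ^ 2 + ∑ i, y i ^ 2)) (g := fun y => V (w, y) + C)
      (((integrable_const _).add hs).const_mul a) ((hVi w).add (integrable_const C))
      fun y => hC (w, y)
    rw [integral_const_mul, integral_add (integrable_const _) hs,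
      integral_add (hVi w) (integrable_const C)] at this
    simp at this
    linarith
  have h1 := ENNReal.toReal_mono (by simp [hk, lintegral_excess_eq ha hC hVi]) hle
  rw [lintegral_excess_eq ha hC hVi, ENNReal.toReal_add hk ENNReal.ofReal_ne_top,
    ENNReal.toReal_ofReal (hnn _)] at h1
  rw [integral_sub (hVi _) (hVi _), show freeEnergy γ (excess V a C) κ z =
    klDiv (Measure.pi fun j => κ j z) (Measure.pi fun _ => γ) +
      ∫⁻ y, excess V a C (z, y) ∂(Measure.pi fun j => κ j z) from rfl,
    lintegral_excess_eq ha hC hVi, ENNReal.toReal_add hk ENNReal.ofReal_ne_top,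
    ENNReal.toReal_ofReal (hnn _)]
  linarith

/-- Convex increments of length at most one are controlled by the unit increments. -/
theorem abs_sub_le_of_strongConvexWith {α : ℝ} (h : StrongConvexWith α V) (hα : 0 ≤ α) (z t : ℝ)
    (y : Fin k → ℝ) (ht : |t| ≤ 1) : |V (z + t, y) - V (z, y)| ≤
      |t| * (|V (z + 1, y) - V (z, y)| + |V (z - 1, y) - V (z, y)|) := by
  have hc : ∀ u v s, 0 ≤ s → s ≤ 1 →
      V ((1 - s) * u + s * v, y) ≤ (1 - s) * V (u, y) + s * V (v, y) := by
    intro u v s h0 h1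
    have := h (u, y) (v, y) s ⟨h0, h1⟩
    have e : (1 - s) • (u, y) + s • (v, y) = ((1 - s) * u + s * v, y) := by
      ext <;> simp
      ring
    have hn : 0 ≤ α / 2 * s * (1 - s) * sqNorm ((u, y) - (v, y)) :=
      mul_nonneg (mul_nonneg (by positivity) (by linarith)) (sqNorm_nonneg _)
    rw [e] at this
    linarith
  have key : ∀ σ : ℝ, ∀ s, 0 ≤ s → s ≤ 1 →
      V (z + s * σ, y) - V (z, y) ≤ s * (V (z + σ, y) - V (z, y)) ∧
      V (z, y) - V (z + s * σ, y) ≤ s * (V (z - σ, y) - V (z, y)) := by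
    intro σ s h0 h1
    have a1 := hc z (z + σ) s h0 h1
    rw [show (1 - s) * z + s * (z + σ) = z + s * σ by ring] at a1
    have hs : 0 < 1 + s := by linarith
    have a2 := hc (z + s * σ) (z - σ) (s / (1 + s)) (by positivity)
      (by rw [div_le_one hs]; linarith)
    rw [show (1 - s / (1 + s)) * (z + s * σ) + s / (1 + s) * (z - σ) = z by field_simp; ring,
      show 1 - s / (1 + s) = (1 + s)⁻¹ by field_simp; ring, div_eq_inv_mul, mul_assoc,
      ← mul_add, le_inv_mul_iff₀ hs] at a2
    constructor <;> linarith
  have b1 := le_abs_self (V (z + 1, y) - V (z, y))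
  have b2 := le_abs_self (V (z - 1, y) - V (z, y))
  have b3 := abs_nonneg (V (z + 1, y) - V (z, y))
  have b4 := abs_nonneg (V (z - 1, y) - V (z, y))
  rw [mul_add]
  rcases le_total 0 t with h0 | h0
  · rw [abs_of_nonneg h0] at ht ⊢
    obtain ⟨c1, c2⟩ := key 1 t h0 ht
    rw [mul_one] at c1 c2
    have d1 := mul_le_mul_of_nonneg_left b1 h0
    have d2 := mul_le_mul_of_nonneg_left b2 h0
    have d3 := mul_nonneg h0 b3
    have d4 := mul_nonneg h0 b4
    rw [abs_le]
    constructor <;> linarith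
  · rw [abs_of_nonpos h0] at ht ⊢
    have h0' : 0 ≤ -t := by linarith
    obtain ⟨c1, c2⟩ := key (-1) (-t) h0' ht
    rw [mul_neg, neg_mul, neg_neg, mul_one] at c1 c2
    rw [sub_neg_eq_add, ← sub_eq_add_neg] at *
    have d1 := mul_le_mul_of_nonneg_left b1 h0'
    have d2 := mul_le_mul_of_nonneg_left b2 h0'
    have d3 := mul_nonneg h0' b3
    have d4 := mul_nonneg h0' b4
    rw [abs_le]
    constructor <;> linarith

end

section
variable {n : ℕ} {V : ℝ × (Fin (n + 1) → ℝ) → ℝ} {a C : ℝ} {p : Measure ℝ}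
  {κ : Fin (n + 1) → Kernel ℝ ℝ}

theorem IsMinimizer.ae_freeEnergy_add_le (h : IsMinimizer (gaussianRef a) (excess V a C) p κ)
    (ha : 0 < a) (hV : Continuous V) (hgr : GrowthCond V) (t : ℝ) :
    ∀ᵐ z ∂(volume : Measure ℝ), freeEnergy (gaussianRef a) (excess V a C) κ (z + t) ≤
      klDiv (Measure.pi fun j => κ j z) (Measure.pi fun _ => gaussianRef a) +
        ∫⁻ y, excess V a C (z + t, y) ∂(Measure.pi fun j => κ j z) := by
  have hκ := h.markov
  have hm : Measurable fun z : ℝ => z - t := by fun_prop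
  have h1 := (absolutelyContinuous_gaussianRef ha).ae_le
    (h.freeEnergy_ae_le (measurable_excess hV) (lintegral_excess_ne_top C hgr ha)
      (κ' := fun j => (κ j).comap (fun z => z - t) hm) fun j => inferInstance)
  have h2 := (measurePreserving_add_right (volume : Measure ℝ) t).quasiMeasurePreserving.ae h1
  filter_upwards [h2] with z hz
  simpa [freeEnergy, Kernel.comap_apply] using hz

theorem IsMinimizer.exists_freeEnergy_eq (h : IsMinimizer (gaussianRef a) (excess V a C) p κ)
    (ha : 0 < a) {α : ℝ} (hα : 0 ≤ α) (hV : ContDiff ℝ 1 V) (hconv : StrongConvexWith α V)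
    (hC : ∀ x, a * sqNorm x ≤ V x + C) (hgr : GrowthCond V) :
    ∃ C₀ : ℝ, ∀ᵐ z ∂(volume : Measure ℝ),
      (freeEnergy (gaussianRef a) (excess V a C) κ z).toReal + a * z ^ 2 =
        C₀ + ∫ s in (0 : ℝ)..z, ∫ y, fderiv ℝ V (s, y) ((1 : ℝ), (0 : Fin (n + 1) → ℝ))
          ∂(Measure.pi fun j => κ j s) := by
  have hκ := h.markov
  have hVc := hV.continuous
  have hT := measurable_excess (a := a) (C := C) hVc
  obtain ⟨B, D, hB, hD, hBD⟩ := h.exists_bounds ha hVc hgr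
  obtain ⟨c₁, hc₁, hg⟩ := hgr (a / 2) (half_pos ha)
  have hexp : ∀ z, ∫⁻ y, ENNReal.ofReal (Real.exp (a / 2 * ∑ i, y i ^ 2))
      ∂(Measure.pi fun j => κ j z) ≤ ENNReal.ofReal (D z) →
      Integrable (fun y : Fin (n + 1) → ℝ => Real.exp (a / 2 * ∑ j, y j ^ 2))
        (Measure.pi fun j => κ j z) := by
    intro z hz
    refine ⟨Continuous.aestronglyMeasurable (by fun_prop), ?_⟩
    rw [hasFiniteIntegral_iff_ofReal (ae_of_all _ fun y => (Real.exp_pos _).le)]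
    exact hz.trans_lt ENNReal.ofReal_lt_top
  have hD0 : ∀ z, Integrable (fun y : Fin (n + 1) → ℝ => Real.exp (a / 2 * ∑ j, y j ^ 2))
        (Measure.pi fun j => κ j z) → ∫⁻ y, ENNReal.ofReal (Real.exp (a / 2 * ∑ i, y i ^ 2))
      ∂(Measure.pi fun j => κ j z) ≤ ENNReal.ofReal (D z) →
      ∫ y, Real.exp (a / 2 * ∑ j, y j ^ 2) ∂(Measure.pi fun j => κ j z) ≤ max (D z) 0 := by
    intro z hi hz
    rw [← ofReal_integral_eq_lintegral_ofReal hi (ae_of_all _ fun y => (Real.exp_pos _).le)] at hz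
    rcases ENNReal.ofReal_le_ofReal_iff'.mp hz with h1 | h1
    · exact h1.trans (le_max_left _ _)
    · exact h1.trans (le_max_right _ _)
  set G : ℝ → ℝ → ℝ := fun t z => ∫ y, (V (z + t, y) - V (z, y)) ∂(Measure.pi fun j => κ j z)
  set w : ℝ → ℝ := fun z => c₁ * Real.exp (a / 2 * (z + 1) ^ 2) +
    c₁ * Real.exp (a / 2 * (z - 1) ^ 2) + 2 * (c₁ * Real.exp (a / 2 * z ^ 2)) with hw
  have hw0 : ∀ z, 0 ≤ w z := fun z => by positivity
  have hg' : ∀ z y, |V (z, y)| ≤ c₁ * Real.exp (a / 2 * z ^ 2) *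
      Real.exp (a / 2 * ∑ i, y i ^ 2) := fun z y => by
    rw [mul_assoc, ← Real.exp_add, ← mul_add]
    exact hg (z, y)
  have hinc : ∀ z t y, |t| ≤ 1 → |V (z + t, y) - V (z, y)| ≤
      w z * Real.exp (a / 2 * ∑ i, y i ^ 2) * |t| := by
    intro z t y ht
    refine (abs_sub_le_of_strongConvexWith hconv hα z t y ht).trans ?_
    rw [mul_comm |t|]
    refine mul_le_mul_of_nonneg_right ?_ (abs_nonneg t)
    have e1 := abs_sub (V (z + 1, y)) (V (z, y))
    have e2 := abs_sub (V (z - 1, y)) (V (z, y))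
    have e3 := hg' (z + 1) y
    have e4 := hg' (z - 1) y
    have e5 := hg' z y
    simp only [hw, add_mul, mul_assoc] at *
    linarith
  refine exists_ae_eq_add_intervalIntegral (G := G) (M := fun z => w z * max (D z) 0)
    ?_ ?_ ?_ ?_ (by fun_prop) ?_
  · have hcont : Continuous fun z => |B z| + a * z ^ 2 := by fun_prop
    refine hcont.locallyIntegrable.mono
      (((measurable_freeEnergy hT hκ).ennreal_toReal).add (by fun_prop)).aestronglyMeasurable ?_
    filter_upwards [hBD] with z hz
    rw [Real.norm_eq_abs, Real.norm_eq_abs, abs_of_nonneg (by positivity),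
      abs_of_nonneg (by positivity)]
    gcongr
    refine ENNReal.toReal_le_of_le_ofReal (abs_nonneg _) (hz.1.trans ?_)
    exact ENNReal.ofReal_le_ofReal (le_abs_self _)
  · intro t
    have hm : StronglyMeasurable fun x : ℝ × (Fin (n + 1) → ℝ) => V (x.1 + t, x.2) - V (x.1, x.2) :=
      Continuous.stronglyMeasurable (by fun_prop)
    exact (hm.integral_kernel_prod_right' (κ := piKernel κ hκ)).aestronglyMeasurable
  · intro t
    filter_upwards [hBD, h.ae_freeEnergy_add_le ha hVc hgr t] with z hz hle
    exact freeEnergy_sub_le hκ ha hC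
      (integrable_potential hVc hgr (half_pos ha) (hexp z hz.2))
      (hz.1.trans_lt ENNReal.ofReal_lt_top).ne hle
  · filter_upwards [hBD] with z hz t ht
    have hi := hexp z hz.2
    calc |G t z| ≤ ∫ y, w z * Real.exp (a / 2 * ∑ i, y i ^ 2) * |t| ∂(Measure.pi fun j => κ j z) :=
          norm_integral_le_of_norm_le (f := fun y => V (z + t, y) - V (z, y))
            ((hi.const_mul _).mul_const _) (ae_of_all _ fun y => hinc z t y ht)
      _ = w z * (∫ y, Real.exp (a / 2 * ∑ i, y i ^ 2) ∂(Measure.pi fun j => κ j z)) * |t| := by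
          rw [integral_mul_const, integral_const_mul]
      _ ≤ w z * max (D z) 0 * |t| := by
          have := hD0 z hi hz.2
          have := hw0 z
          gcongr
  · filter_upwards [hBD] with z hz
    have hi := hexp z hz.2
    refine (hasDerivAt_integral_of_linear_bound (F := fun t y => V (z + t, y) - V (z, y))
      (fun t => Continuous.aestronglyMeasurable (by fun_prop))
      (ae_of_all _ fun y t ht => hinc z t y ht) (hi.const_mul (w z)) (ae_of_all _ fun y => ?_)).2
    have hd : HasFDerivAt V (fderiv ℝ V (z + 0, y)) (z + 0, y) :=
      (hV.differentiable one_ne_zero _).hasFDerivAt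
    have hl : HasDerivAt (fun t : ℝ => (z + t, y)) ((1 : ℝ), (0 : Fin (n + 1) → ℝ)) 0 :=
      ((hasDerivAt_id (0 : ℝ)).const_add z).prodMk (hasDerivAt_const 0 y)
    simpa using (hd.comp_hasDerivAt (0 : ℝ) hl).sub_const (V (z, y))

theorem IsMinimizer.root_eq (h : IsMinimizer (gaussianRef a) (excess V a C) p κ)
    (ha : 0 < a) {α : ℝ} (hα : 0 ≤ α) (hV : ContDiff ℝ 1 V) (hconv : StrongConvexWith α V)
    (hC : ∀ x, a * sqNorm x ≤ V x + C) (hgr : GrowthCond V) :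
    ∃ c : ℝ, 0 < c ∧ p = volume.withDensity fun z => ENNReal.ofReal (c * Real.exp
      (-(∫ s in (0 : ℝ)..z, ∫ y, fderiv ℝ V (s, y) ((1 : ℝ), (0 : Fin (n + 1) → ℝ))
        ∂(Measure.pi fun j => κ j s)))) := by
  have hκ := h.markov
  have hp := h.prob
  have hT := measurable_excess (a := a) (C := C) hV.continuous
  have hfin := lintegral_excess_ne_top C hgr ha
  have hF := measurable_freeEnergy (γ := gaussianRef a) hT hκ
  obtain ⟨C₀, hC₀⟩ := h.exists_freeEnergy_eq ha hα hV hconv hC hgr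
  obtain ⟨c, hc, hγ⟩ := exists_gaussianRef_eq ha
  have hne := h.freeEnergy_ae_ne_top hT hfin
  have h0 : partition (gaussianRef a) (freeEnergy (gaussianRef a) (excess V a C) κ) ≠ 0 :=
    partition_ne_zero hF (.refl _) hne
  set N := (partition (gaussianRef a) (freeEnergy (gaussianRef a) (excess V a C) κ)).toReal
    with hN
  have hN0 : 0 < N := ENNReal.toReal_pos h0 partition_ne_top
  have hNinv : (partition (gaussianRef a) (freeEnergy (gaussianRef a) (excess V a C) κ))⁻¹ =
      ENNReal.ofReal N⁻¹ := by
    rw [ENNReal.ofReal_inv_of_pos hN0, ENNReal.ofReal_toReal partition_ne_top]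
  refine ⟨c * N⁻¹ * Real.exp (-C₀), by positivity, ?_⟩
  nth_rw 1 [h.eq_gibbsTilt hT]
  rw [gibbsTilt_eq_withDensity hF, hNinv]
  nth_rw 1 [hγ]
  rw [← withDensity_mul _ (by fun_prop) ((measurable_boltz_comp hF).const_mul _)]
  refine withDensity_congr_ae ?_
  filter_upwards [hC₀, (absolutelyContinuous_gaussianRef ha).ae_le hne] with z hz hz'
  rw [Pi.mul_apply, boltz_of_ne_top hz', ← ENNReal.ofReal_mul (by positivity),
    ← ENNReal.ofReal_mul (by positivity)]
  congr 1
  rw [mul_assoc _ (Real.exp (-C₀)), ← Real.exp_add, ← neg_add, ← hz, neg_add, Real.exp_add]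
  ring

end

end StarVI

/-- **Self-consistency equations for the SSVI minimizer** (d = k+1 ≥ 2). The star minimizer
`π⋆ = p ⊗ ∏ⱼ κ j` with differentiable density satisfies
`p(z₁) ∝ exp (-∫₀^{z₁} ∫ ∂₁V(s, z₋₁) q⋆(dz₋₁ ∣ s) ds)` and, for each leaf `i`,
`q⋆_i(z_i ∣ z₁) ∝ exp (-∫ V(z₁, z_i, z_{-{1,i}}) ∏_{j ≠ i} q⋆_j(dz_j ∣ z₁))`. -/
theorem stmt2 {k : ℕ} (hk : 1 ≤ k)
    (V : ℝ × (Fin k → ℝ) → ℝ) (α : ℝ) (hα : 0 < α)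
    (hV : ContDiff ℝ 2 V) (hconv : StrongConvexWith α V) (hgr : GrowthCond V)
    (π : Measure (ℝ × (Fin k → ℝ))) [IsProbabilityMeasure π] (hπ : π = gibbs V)
    (p : Measure ℝ) (κ : Fin k → Kernel ℝ ℝ)
    (hp : IsProbabilityMeasure p) (hκ : ∀ j, IsMarkovKernel (κ j))
    (hstar : IsStar (starMeasure p κ))
    (hmin : ∀ μ, IsStar μ → KL (starMeasure p κ) π ≤ KL μ π)
    (hdiff : ∃ f : ℝ × (Fin k → ℝ) → ℝ, (∀ z, 0 ≤ f z) ∧ Differentiable ℝ f ∧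
      starMeasure p κ = volume.withDensity fun z => ENNReal.ofReal (f z)) :
    (∃ c : ℝ, 0 < c ∧
      p = volume.withDensity fun z₁ => ENNReal.ofReal (c * Real.exp
        (-(∫ s in (0:ℝ)..z₁,
            ∫ y, fderiv ℝ V (s, y) ((1:ℝ), (0 : Fin k → ℝ))
              ∂(Measure.pi fun j => κ j s))))) ∧
    (∀ i : Fin k, ∀ᵐ z₁ ∂p, ∃ c : ℝ, 0 < c ∧
      κ i z₁ = volume.withDensity fun zi => ENNReal.ofReal (c * Real.exp
        (-(∫ y, V (z₁, Function.update y i zi)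
            ∂(Measure.pi fun j => κ j z₁))))) := by
  obtain ⟨n, rfl⟩ : ∃ n, k = n + 1 := ⟨k - 1, by omega⟩
  have ha : 0 < α / 4 := by positivity
  obtain ⟨C, hC⟩ := StarVI.exists_quadratic_le hconv hα (hV.differentiable two_ne_zero 0)
  have h := StarVI.isMinimizer_excess ha hV.continuous hC hgr hπ hp hκ hmin
  refine ⟨h.root_eq ha hα.le (hV.of_le one_le_two) hconv hC hgr, fun i => ?_⟩
  have hac : p ≪ volume := (h.absolutelyContinuous (StarVI.measurable_excess hV.continuous)).trans
    (StarVI.gaussianRef_absolutelyContinuous ha)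
  exact hac.ae_le (h.leaf_eq ha hV.continuous hC hgr i)
end

section
/- Let π = N(m, Σ) be a nondegenerate Gaussian on ℝ^d (d ≥ 2) with covariance entries σ_{ij}, and let σ^{11} denote the (1,1)-entry of Σ^{−1}. Then the gap between the star-structured and mean-field variational approximations satisfies: ( inf over μ ∈ C_star of KL(μ ‖ π) ) − ( inf over μ ∈ P(ℝ)^{⊗d} of KL(μ ‖ π) ) = −(1/2) log( σ₁₁ / (σ^{11})^{−1} ) ≤ 0. -/
open MeasureTheory ProbabilityTheory
open scoped ENNReal ProbabilityTheory

/-- The star-structured measure on `ℝ^d` with root coordinate `0`: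
`μ₁(dz₁) ∏_{j ≠ 0} κ_j(dz_j ∣ z₁)`. -/
noncomputable def starMeasurePi {d : ℕ} [NeZero d]
    (μ₁ : Measure ℝ) (κ : Fin d → Kernel ℝ ℝ) : Measure (Fin d → ℝ) :=
  μ₁.bind fun z₁ => Measure.pi fun j => if j = 0 then Measure.dirac z₁ else κ j z₁

/-- `μ ∈ C_star` on `ℝ^d` (root coordinate `0`). -/
def IsStarPi {d : ℕ} [NeZero d] (μ : Measure (Fin d → ℝ)) : Prop :=
  IsProbabilityMeasure μ ∧
    ∃ (μ₁ : Measure ℝ) (κ : Fin d → Kernel ℝ ℝ),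
      IsProbabilityMeasure μ₁ ∧ (∀ j, IsMarkovKernel (κ j)) ∧ μ = starMeasurePi μ₁ κ

/-- Density of the multivariate Gaussian `N(m, S)` on `ℝ^d` (for `S ≻ 0`). -/
noncomputable def gaussDensity {d : ℕ} (m : Fin d → ℝ) (S : Matrix (Fin d) (Fin d) ℝ)
    (z : Fin d → ℝ) : ℝ :=
  (Real.sqrt ((2 * Real.pi) ^ d * S.det))⁻¹ *
    Real.exp (-(∑ i, ∑ j, (z i - m i) * S⁻¹ i j * (z j - m j)) / 2)

/-- The multivariate Gaussian `N(m, S)` on `ℝ^d` (for `S ≻ 0`). -/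
noncomputable def gaussPi {d : ℕ} (m : Fin d → ℝ) (S : Matrix (Fin d) (Fin d) ℝ) :
    Measure (Fin d → ℝ) :=
  volume.withDensity fun z => ENNReal.ofReal (gaussDensity m S z)

section Gibbs

variable {E : Type*} [MeasurableSpace E] {μ π lam : Measure E}

lemma KL_ne_top_iff :
    KL μ π ≠ ⊤ ↔ μ ≪ π ∧ Integrable (fun z => Real.log (μ.rnDeriv π z).toReal) μ := by
  unfold KL
  split_ifs with h <;> simp [h]

lemma lintegral_div_rnDeriv_le [SigmaFinite μ] [SigmaFinite π] (hμ : μ ≪ π) {q : E → ℝ≥0∞}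
    (hq : Measurable q) :
    ∫⁻ z, q z / μ.rnDeriv π z ∂μ ≤ ∫⁻ z, q z ∂π := by
  have hm : Measurable fun z => q z / μ.rnDeriv π z := hq.div (Measure.measurable_rnDeriv μ π)
  rw [← lintegral_rnDeriv_mul hμ hm.aemeasurable]
  exact lintegral_mono fun z => ENNReal.mul_div_le

lemma rnDeriv_toReal_pos [SigmaFinite μ] [SigmaFinite π] (hμ : μ ≪ π) :
    ∀ᵐ z ∂μ, 0 < (μ.rnDeriv π z).toReal := by
  filter_upwards [Measure.rnDeriv_pos hμ, hμ.ae_le (Measure.rnDeriv_lt_top μ π)] with z h0 h1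
  exact ENNReal.toReal_pos h0.ne' h1.ne

lemma lintegral_ofReal_div_rnDeriv_le [SigmaFinite μ] [SigmaFinite π] (hμ : μ ≪ π) {q : E → ℝ}
    (hq : Measurable q) :
    ∫⁻ z, ENNReal.ofReal (q z / (μ.rnDeriv π z).toReal) ∂μ ≤ ∫⁻ z, ENNReal.ofReal (q z) ∂π := by
  refine le_trans (le_of_eq (lintegral_congr_ae ?_))
    (lintegral_div_rnDeriv_le hμ hq.ennreal_ofReal)
  filter_upwards [rnDeriv_toReal_pos hμ, hμ.ae_le (Measure.rnDeriv_lt_top μ π)] with z h0 h1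
  rw [ENNReal.ofReal_div_of_pos h0, ENNReal.ofReal_toReal h1.ne]

lemma integrable_div_rnDeriv [SigmaFinite μ] [SigmaFinite π] (hμ : μ ≪ π) {q : E → ℝ}
    (hq : Measurable q) (hq0 : ∀ z, 0 ≤ q z) (hfin : ∫⁻ z, ENNReal.ofReal (q z) ∂π ≠ ⊤) :
    Integrable (fun z => q z / (μ.rnDeriv π z).toReal) μ := by
  refine ⟨(hq.div (Measure.measurable_rnDeriv μ π).ennreal_toReal).aestronglyMeasurable, ?_⟩
  rw [hasFiniteIntegral_iff_ofReal
    (Filter.Eventually.of_forall fun z => div_nonneg (hq0 z) ENNReal.toReal_nonneg)]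
  exact (lintegral_ofReal_div_rnDeriv_le hμ hq).trans_lt hfin.lt_top

/-- A nonnegative function with an exponential moment under `π` is integrable under every
measure of finite divergence from `π`. -/
lemma integrable_of_KL_ne_top [SigmaFinite μ] [SigmaFinite π] (hKL : KL μ π ≠ ⊤) {h : E → ℝ}
    (hh : Measurable h) (h0 : ∀ z, 0 ≤ h z)
    (hfin : ∫⁻ z, ENNReal.ofReal (Real.exp (h z)) ∂π ≠ ⊤) : Integrable h μ := by
  obtain ⟨hμ, hlog⟩ := KL_ne_top_iff.1 hKL
  refine (hlog.add (integrable_div_rnDeriv hμ (Real.measurable_exp.comp hh)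
    (fun z => (Real.exp_pos _).le) hfin)).mono' hh.aestronglyMeasurable ?_
  filter_upwards [rnDeriv_toReal_pos hμ] with z hz
  rw [Real.norm_of_nonneg (h0 z)]
  simp only [Pi.add_apply, Function.comp_apply]
  have := Real.log_le_sub_one_of_pos (div_pos (Real.exp_pos (h z)) hz)
  rw [Real.log_div (Real.exp_pos _).ne' hz.ne', Real.log_exp] at this
  linarith

variable {p g : E → ℝ}

/-- Gibbs' inequality: replacing `μ` by a sub-probability density `p` in the logarithm lowers the
divergence. -/
lemma ofReal_integral_log_div_le_KL [SigmaFinite lam] [IsProbabilityMeasure μ]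
    (hp : Measurable p) (hg : Measurable g) (hp0 : ∀ z, 0 < p z) (hg0 : ∀ z, 0 < g z)
    (hp1 : ∫⁻ z, ENNReal.ofReal (p z) ∂lam ≤ 1)
    (hKL : KL μ (lam.withDensity fun z => ENNReal.ofReal (g z)) ≠ ⊤)
    (hint : Integrable (fun z => Real.log (p z / g z)) μ) :
    ENNReal.ofReal (∫ z, Real.log (p z / g z) ∂μ) ≤
      KL μ (lam.withDensity fun z => ENNReal.ofReal (g z)) := by
  have : SigmaFinite (lam.withDensity fun z => ENNReal.ofReal (g z)) :=
    SigmaFinite.withDensity_ofReal _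
  have hpg : Measurable fun z => p z / g z := hp.div hg
  set π := lam.withDensity fun z => ENNReal.ofReal (g z) with hπ
  have hq : ∫⁻ z, ENNReal.ofReal (p z / g z) ∂π ≤ 1 := by
    rw [hπ, lintegral_withDensity_eq_lintegral_mul _ hg.ennreal_ofReal
      hpg.ennreal_ofReal]
    refine le_trans (le_of_eq (lintegral_congr fun z => ?_)) hp1
    rw [Pi.mul_apply, ← ENNReal.ofReal_mul (hg0 z).le, mul_div_cancel₀ _ (hg0 z).ne']
  obtain ⟨hμ, hlog⟩ := KL_ne_top_iff.1 hKL
  have hi : Integrable (fun z => p z / g z / (μ.rnDeriv π z).toReal) μ :=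
    integrable_div_rnDeriv hμ hpg (fun z => (div_pos (hp0 z) (hg0 z)).le)
      (ne_top_of_le_ne_top ENNReal.one_ne_top hq)
  have hle : ∫ z, p z / g z / (μ.rnDeriv π z).toReal ∂μ ≤ 1 := by
    rw [integral_eq_lintegral_of_nonneg_ae (Filter.Eventually.of_forall fun z =>
      div_nonneg (div_pos (hp0 z) (hg0 z)).le ENNReal.toReal_nonneg) hi.1]
    exact ENNReal.toReal_le_of_le_ofReal zero_le_one (by
      simpa using (lintegral_ofReal_div_rnDeriv_le hμ hpg).trans hq)
  rw [KL, if_pos ⟨hμ, hlog⟩]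
  refine ENNReal.ofReal_le_ofReal ?_
  have hi1 : Integrable (fun z => p z / g z / (μ.rnDeriv π z).toReal - 1) μ :=
    hi.sub (integrable_const 1)
  have key : ∫ z, Real.log (p z / g z) ∂μ ≤
      ∫ z, (Real.log (μ.rnDeriv π z).toReal + (p z / g z / (μ.rnDeriv π z).toReal - 1)) ∂μ := by
    refine integral_mono_ae hint (hlog.add hi1) ?_
    filter_upwards [rnDeriv_toReal_pos hμ] with z hz
    have hpg := div_pos (hp0 z) (hg0 z)
    have := Real.log_le_sub_one_of_pos (div_pos hpg hz)
    rw [Real.log_div hpg.ne' hz.ne'] at this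
    linarith
  rw [integral_add hlog hi1, integral_sub hi (integrable_const 1)] at key
  simp only [integral_const, probReal_univ, smul_eq_mul, mul_one] at key
  linarith

lemma KL_withDensity [SigmaFinite lam]
    (hp : Measurable p) (hg : Measurable g) (hp0 : ∀ z, 0 < p z) (hg0 : ∀ z, 0 < g z)
    (hint : Integrable (fun z => Real.log (p z / g z))
      (lam.withDensity fun z => ENNReal.ofReal (p z))) :
    KL (lam.withDensity fun z => ENNReal.ofReal (p z))
        (lam.withDensity fun z => ENNReal.ofReal (g z)) =
      ENNReal.ofReal (∫ z, Real.log (p z / g z)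
        ∂(lam.withDensity fun z => ENNReal.ofReal (p z))) := by
  have : SigmaFinite (lam.withDensity fun z => ENNReal.ofReal (g z)) :=
    SigmaFinite.withDensity_ofReal _
  have hpg : Measurable fun z => p z / g z := hp.div hg
  have heq : (lam.withDensity fun z => ENNReal.ofReal (p z)) =
      (lam.withDensity fun z => ENNReal.ofReal (g z)).withDensity
        fun z => ENNReal.ofReal (p z / g z) := by
    rw [← withDensity_mul _ hg.ennreal_ofReal hpg.ennreal_ofReal]
    congr 1
    ext z
    rw [Pi.mul_apply, ← ENNReal.ofReal_mul (hg0 z).le, mul_div_cancel₀ _ (hg0 z).ne']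
  set μ := lam.withDensity fun z => ENNReal.ofReal (p z) with hμ'
  set π := lam.withDensity fun z => ENNReal.ofReal (g z) with hπ
  have hμ : μ ≪ π := by rw [heq]; exact withDensity_absolutelyContinuous _ _
  have hrn : (fun z => Real.log (μ.rnDeriv π z).toReal) =ᵐ[μ] fun z => Real.log (p z / g z) := by
    have := Measure.rnDeriv_withDensity π hpg.ennreal_ofReal
    rw [← heq] at this
    filter_upwards [hμ.ae_le this] with z hz
    rw [hz, ENNReal.toReal_ofReal (div_pos (hp0 z) (hg0 z)).le]
  rw [KL, if_pos ⟨hμ, hint.congr hrn.symm⟩, integral_congr_ae hrn]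

end Gibbs

section QuadForm

open Matrix

variable {d : ℕ}

/-- The quadratic form `x ↦ xᵀ Q x`. -/
noncomputable def quadForm (Q : Matrix (Fin d) (Fin d) ℝ) (x : Fin d → ℝ) : ℝ :=
  ∑ i, ∑ j, x i * Q i j * x j

lemma quadForm_eq_dotProduct (Q : Matrix (Fin d) (Fin d) ℝ) (x : Fin d → ℝ) :
    quadForm Q x = x ⬝ᵥ Q *ᵥ x := by
  simp only [quadForm, dotProduct, mulVec, Finset.mul_sum, mul_assoc]

lemma quadForm_nonneg {Q : Matrix (Fin d) (Fin d) ℝ} (hQ : Q.PosDef) (x : Fin d → ℝ) :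
    0 ≤ quadForm Q x := by
  rw [quadForm_eq_dotProduct]
  simpa using hQ.posSemidef.dotProduct_mulVec_nonneg x

lemma quadForm_add {Q : Matrix (Fin d) (Fin d) ℝ} (hQ : Q.IsSymm) (x y : Fin d → ℝ) :
    quadForm Q (x + y) = quadForm Q x + 2 * (y ⬝ᵥ Q *ᵥ x) + quadForm Q y := by
  have hs : x ⬝ᵥ Q *ᵥ y = y ⬝ᵥ Q *ᵥ x := by
    rw [dotProduct_mulVec, ← mulVec_transpose, hQ.eq, dotProduct_comm]
  simp only [quadForm_eq_dotProduct, mulVec_add, dotProduct_add, add_dotProduct, hs]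
  ring

lemma quadForm_single (Q : Matrix (Fin d) (Fin d) ℝ) (i : Fin d) (t : ℝ) :
    quadForm Q (Pi.single i t) = Q i i * t ^ 2 := by
  rw [quadForm_eq_dotProduct]
  simp
  ring

variable {S : Matrix (Fin d) (Fin d) ℝ}

lemma Matrix.PosDef.isSymm (hS : S.PosDef) : S.IsSymm := by
  simpa [Matrix.IsHermitian, Matrix.IsSymm, conjTranspose_eq_transpose_of_trivial] using
    hS.isHermitian

lemma Matrix.PosDef.inv_mulVec_mulVec (hS : S.PosDef) (x : Fin d → ℝ) : S⁻¹ *ᵥ (S *ᵥ x) = x := by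
  rw [mulVec_mulVec, nonsing_inv_mul _ (isUnit_iff_ne_zero.2 hS.det_pos.ne'), one_mulVec]

lemma quadForm_inv_smul_col (hS : S.PosDef) (i : Fin d) (t : ℝ) :
    quadForm S⁻¹ (fun j => S j i * t) = S i i * t ^ 2 := by
  have : (fun j => S j i * t) = S *ᵥ Pi.single i t := by ext; simp
  rw [quadForm_eq_dotProduct, this, hS.inv_mulVec_mulVec]
  simp
  ring

lemma sq_le_mul_quadForm_inv (hS : S.PosDef) (x : Fin d → ℝ) (i : Fin d) :
    x i ^ 2 ≤ S i i * quadForm S⁻¹ x := by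
  have hpos := hS.diag_pos (i := i)
  have h := quadForm_nonneg hS.inv ((fun j => S j i * (-(x i / S i i))) + x)
  have hc : (fun j => S j i * (-(x i / S i i))) = S *ᵥ Pi.single i (-(x i / S i i)) := by
    ext; simp [div_eq_mul_inv]
  rw [quadForm_add hS.inv.isSymm, quadForm_inv_smul_col hS, hc, hS.inv_mulVec_mulVec] at h
  simp only [dotProduct_single] at h
  have : S i i * (S i i * (-(x i / S i i)) ^ 2 + 2 * (x i * -(x i / S i i)) + quadForm S⁻¹ x) =
      S i i * quadForm S⁻¹ x - x i ^ 2 := by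
    field_simp
    ring
  nlinarith [mul_nonneg hpos.le h]

lemma one_le_mul_inv_diag (hS : S.PosDef) (i : Fin d) : 1 ≤ S i i * S⁻¹ i i := by
  simpa [quadForm_single] using sq_le_mul_quadForm_inv hS (Pi.single i 1) i

lemma det_le_one_of_diag_eq_one {A : Matrix (Fin d) (Fin d) ℝ} (hA : A.PosDef)
    (hd : ∀ i, A i i = 1) : A.det ≤ 1 := by
  have htr : ∑ i, (hA.isHermitian.eigenvalues i - 1) = 0 := by
    have := hA.isHermitian.trace_eq_sum_eigenvalues
    simp only [trace, diag_apply, hd, RCLike.ofReal_real_eq_id, id] at this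
    rw [Finset.sum_sub_distrib, ← this, sub_self]
  rw [hA.isHermitian.det_eq_prod_eigenvalues]
  calc ∏ i, (hA.isHermitian.eigenvalues i : ℝ)
      ≤ ∏ i, Real.exp (hA.isHermitian.eigenvalues i - 1) :=
        Finset.prod_le_prod (fun i _ => (hA.eigenvalues_pos i).le) fun i _ => by
          linarith [Real.add_one_le_exp (hA.isHermitian.eigenvalues i - 1)]
    _ = 1 := by rw [← Real.exp_sum, htr, Real.exp_zero]

/-- **Hadamard's determinant inequality** for positive definite matrices. -/
lemma Matrix.PosDef.det_le_prod_diag {A : Matrix (Fin d) (Fin d) ℝ} (hA : A.PosDef) :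
    A.det ≤ ∏ i, A i i := by
  set D : Matrix (Fin d) (Fin d) ℝ := diagonal fun i => (√(A i i))⁻¹ with hD
  have hs : ∀ i, 0 < √(A i i) := fun i => Real.sqrt_pos.2 hA.diag_pos
  have hdet : D.det * D.det * ∏ i, A i i = 1 := by
    rw [hD, det_diagonal, ← Finset.prod_mul_distrib, ← Finset.prod_mul_distrib]
    refine Finset.prod_eq_one fun i _ => ?_
    rw [← mul_inv, Real.mul_self_sqrt hA.diag_pos.le, inv_mul_cancel₀ hA.diag_pos.ne']
  have hu : IsUnit D := by
    rw [isUnit_iff_isUnit_det, isUnit_iff_ne_zero]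
    rintro h
    simp [h] at hdet
  have hB : (Dᴴ * A * D).PosDef := hA.conjTranspose_mul_mul_same (mulVec_injective_of_isUnit hu)
  have h1 := det_le_one_of_diag_eq_one hB fun i => by
    rw [hD, diagonal_conjTranspose, mul_diagonal, diagonal_mul]
    simp only [star_trivial]
    rw [mul_assoc, mul_comm (A i i), ← mul_assoc, ← mul_inv, Real.mul_self_sqrt hA.diag_pos.le,
      inv_mul_cancel₀ hA.diag_pos.ne']
  rw [det_mul, det_mul, det_conjTranspose, star_trivial] at h1
  have hP : 0 < ∏ i, A i i := Finset.prod_pos fun i _ => hA.diag_pos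
  nlinarith [mul_le_mul_of_nonneg_left h1 hP.le]

/-- Hadamard's inequality for the block of `S⁻¹` complementary to the index `k`. -/
lemma mul_det_inv_le_prod_diag (hS : S.PosDef) (k : Fin d) :
    S k k * S⁻¹.det ≤ ∏ i ∈ Finset.univ.erase k, S⁻¹ i i := by
  have hpos := hS.diag_pos (i := k)
  set b : Fin d → ℝ := S *ᵥ Pi.single k (S k k)⁻¹ with hb
  set C : Matrix (Fin d) (Fin d) ℝ := updateCol 1 k b with hC
  have hdet : C.det = 1 := by
    rw [hC, ← cramer_apply, cramer_one]
    simp [hb, hpos.ne']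
  have hu : IsUnit C := by
    rw [isUnit_iff_isUnit_det, hdet]
    exact isUnit_one
  have hB : (Cᴴ * S⁻¹ * C).PosDef :=
    hS.inv.conjTranspose_mul_mul_same (mulVec_injective_of_isUnit hu)
  have hdiag : ∀ i, (Cᴴ * S⁻¹ * C) i i = quadForm S⁻¹ (C.col i) := fun i => by
    rw [quadForm_eq_dotProduct, dotProduct_mulVec, mul_apply]
    simp [dotProduct, vecMul, mul_apply]
  have h := hB.det_le_prod_diag
  rw [det_mul, det_mul, det_conjTranspose, hdet, ← Finset.mul_prod_erase _ _ (Finset.mem_univ k),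
    hdiag] at h
  have hk : quadForm S⁻¹ (C.col k) = (S k k)⁻¹ := by
    have : C.col k = fun j => S j k * (S k k)⁻¹ := by
      ext j
      simp [hC, hb]
    rw [this, quadForm_inv_smul_col hS]
    field_simp
  rw [hk, Finset.prod_congr rfl (g := fun i => S⁻¹ i i)] at h
  · simp only [star_one, one_mul, mul_one] at h
    calc S k k * S⁻¹.det ≤ S k k * ((S k k)⁻¹ * ∏ i ∈ Finset.univ.erase k, S⁻¹ i i) := by gcongr
      _ = _ := by rw [← mul_assoc, mul_inv_cancel₀ hpos.ne', one_mul]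
  · intro i hi
    have : C.col i = Pi.single i 1 := by
      ext j
      simp [hC, updateCol_ne (Finset.ne_of_mem_erase hi), one_apply, Pi.single_apply]
    rw [hdiag, this, quadForm_single, one_pow, mul_one]

end QuadForm

section PiKernel

variable {ι α : Type*} [Fintype ι] [MeasurableSpace α]

/-- The kernel sending `x` to the product of the measures `K j x`. -/
noncomputable def piKernel (K : ι → Kernel α ℝ) [∀ j, IsMarkovKernel (K j)] :
    Kernel α (ι → ℝ) where
  toFun x := Measure.pi fun j => K j x
  measurable' := by
    refine .measure_of_isPiSystem_of_isProbabilityMeasure generateFrom_pi.symm isPiSystem_pi ?_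
    rintro _ ⟨t, ht, rfl⟩
    simp only [Measure.pi_pi]
    exact Finset.measurable_prod _ fun j _ => (K j).measurable_coe (ht j (Set.mem_univ j))

variable (K : ι → Kernel α ℝ) [∀ j, IsMarkovKernel (K j)]

lemma piKernel_apply (x : α) : piKernel K x = Measure.pi fun j => K j x := rfl

instance : IsMarkovKernel (piKernel K) := ⟨fun x => by rw [piKernel_apply]; infer_instance⟩

lemma map_eval_comp_piKernel (μ : Measure α) (j : ι) :
    (piKernel K ∘ₘ μ).map (fun z => z j) = K j ∘ₘ μ := by
  rw [Measure.map_comp _ _ (measurable_pi_apply j)]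
  congr 1
  ext1 x
  rw [Kernel.map_apply _ (measurable_pi_apply j), piKernel_apply]
  exact (measurePreserving_eval _ j).map_eq

lemma integral_comp_measure {β : Type*} [MeasurableSpace β] {η : Kernel α β} {μ : Measure α}
    {f : β → ℝ} (hf : Integrable f (η ∘ₘ μ)) : ∫ z, f z ∂(η ∘ₘ μ) = ∫ x, ∫ z, f z ∂η x ∂μ := by
  rw [Measure.comp_eq_comp_const_apply] at hf ⊢
  rw [Kernel.integral_comp hf, Kernel.const_apply]

variable {K} {μ : Measure α}

lemma ae_memLp_of_memLp_comp {κ : Kernel α ℝ} [IsMarkovKernel κ] (h : MemLp id 2 (κ ∘ₘ μ)) :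
    ∀ᵐ x ∂μ, MemLp id 2 (κ x) := by
  have h2 := (memLp_two_iff_integrable_sq aestronglyMeasurable_id).1 h
  filter_upwards [((Measure.integrable_comp_iff h2.1).1 h2).1] with x hx
  exact (memLp_two_iff_integrable_sq aestronglyMeasurable_id).2 hx

/-- Conditional means of a square integrable variable are square integrable. -/
lemma memLp_integral_of_memLp_comp {κ : Kernel α ℝ} [IsMarkovKernel κ]
    (h : MemLp id 2 (κ ∘ₘ μ)) : MemLp (fun x => ∫ y, y ∂κ x) 2 μ := by
  have h2 := (memLp_two_iff_integrable_sq aestronglyMeasurable_id).1 h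
  have hm : Measurable fun x => ∫ y, y ∂κ x :=
    (stronglyMeasurable_id.integral_kernel (κ := κ)).measurable
  rw [memLp_two_iff_integrable_sq hm.aestronglyMeasurable]
  refine ((Measure.integrable_comp_iff h2.1).1 h2).2.mono' (hm.pow_const 2).aestronglyMeasurable ?_
  filter_upwards [ae_memLp_of_memLp_comp h] with x hx
  have := variance_nonneg id (κ x)
  rw [variance_eq_sub hx] at this
  simpa using this

end PiKernel

section CondMean

variable {d : ℕ} {P : Fin d → Measure ℝ} [∀ j, IsProbabilityMeasure (P j)]

lemma memLp_eval {j : Fin d} (h : MemLp id 2 (P j)) :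
    MemLp (fun z : Fin d → ℝ => z j) 2 (Measure.pi P) :=
  h.comp_measurePreserving (measurePreserving_eval P j)

lemma integral_eval_pi (j : Fin d) : ∫ z, z j ∂Measure.pi P = ∫ y, y ∂P j :=
  integral_comp_eval (X := fun _ => ℝ) (μ := P) (f := fun y => y) aestronglyMeasurable_id

lemma integral_mul_eval_sub {i j : Fin d} (hij : i ≠ j) (h : ∀ j, MemLp id 2 (P j)) (a b : ℝ) :
    ∫ z, (z i - a) * (z j - b) ∂Measure.pi P =
      (∫ y, y ∂P i - a) * (∫ y, y ∂P j - b) := by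
  have hind : IndepFun (fun z : Fin d → ℝ => z i - a) (fun z => z j - b) (Measure.pi P) :=
    ((iIndepFun_pi (μ := P) (X := fun _ y => y) fun _ => aemeasurable_id).indepFun hij).comp
      (φ := fun y => y - a) (ψ := fun y => y - b) (by fun_prop) (by fun_prop)
  have hm (k : Fin d) (c : ℝ) :
      AEStronglyMeasurable (fun z : Fin d → ℝ => z k - c) (Measure.pi P) := by
    have : Measurable fun z : Fin d → ℝ => z k - c := by fun_prop
    exact this.aestronglyMeasurable
  rw [hind.integral_fun_mul_eq_mul_integral (hm i a) (hm j b),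
    integral_sub ((memLp_eval (h i)).integrable one_le_two) (integrable_const _),
    integral_sub ((memLp_eval (h j)).integrable one_le_two) (integrable_const _),
    integral_eval_pi, integral_eval_pi]
  simp

lemma integral_sq_eval_sub {j : Fin d} (h : MemLp id 2 (P j)) (a : ℝ) :
    ∫ z, ((z j - a) * (z j - a) - (z j - ∫ y, y ∂P j) ^ 2) ∂Measure.pi P =
      (∫ y, y ∂P j - a) * (∫ y, y ∂P j - a) := by
  have hi := (memLp_eval h).integrable one_le_two
  have : ∀ z : Fin d → ℝ, (z j - a) * (z j - a) - (z j - ∫ y, y ∂P j) ^ 2 =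
      2 * (∫ y, y ∂P j - a) * z j + (a ^ 2 - (∫ y, y ∂P j) ^ 2) := fun z => by ring
  simp_rw [this]
  rw [integral_add (hi.const_mul _) (integrable_const _), integral_const_mul, integral_eval_pi]
  simp
  ring

lemma integral_quadForm_sub (h : ∀ j, MemLp id 2 (P j)) (Q : Matrix (Fin d) (Fin d) ℝ)
    (m : Fin d → ℝ) :
    ∫ z, (quadForm Q (z - m) - ∑ j, Q j j * (z j - ∫ y, y ∂P j) ^ 2) ∂Measure.pi P =
      quadForm Q ((fun j => ∫ y, y ∂P j) - m) := by
  have hL (j : Fin d) (a : ℝ) : MemLp (fun z : Fin d → ℝ => z j - a) 2 (Measure.pi P) :=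
    (memLp_eval (h j)).sub (memLp_const a)
  set F : Fin d → Fin d → (Fin d → ℝ) → ℝ := fun i j z =>
    (z i - m i) * (z j - m j) - if i = j then (z j - ∫ y, y ∂P j) ^ 2 else 0 with hF
  have hint : ∀ i j, Integrable (F i j) (Measure.pi P) := fun i j => by
    refine ((hL i (m i)).integrable_mul (hL j (m j))).sub ?_
    split_ifs
    · exact (hL j _).integrable_sq
    · exact integrable_zero _ _ _
  have hFi : ∀ i j, ∫ z, F i j z ∂Measure.pi P =
      (∫ y, y ∂P i - m i) * (∫ y, y ∂P j - m j) := fun i j => by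
    by_cases hij : i = j
    · subst hij
      simpa [hF] using integral_sq_eval_sub (h i) (m i)
    · simpa [hF, hij] using integral_mul_eval_sub hij h (m i) (m j)
  have hsum : ∀ z, quadForm Q (z - m) - ∑ j, Q j j * (z j - ∫ y, y ∂P j) ^ 2 =
      ∑ i, ∑ j, Q i j * F i j z := fun z => by
    have (i j : Fin d) : Q i j * F i j z = (z - m) i * Q i j * (z - m) j -
        if i = j then Q i j * (z j - ∫ y, y ∂P j) ^ 2 else 0 := by
      simp only [hF, Pi.sub_apply]
      split_ifs <;> ring
    simp only [this, quadForm, Finset.sum_sub_distrib, Finset.sum_ite_eq, Finset.mem_univ, if_true]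
  simp_rw [hsum]
  refine (integral_finsetSum _ fun i _ =>
    integrable_finsetSum _ fun j _ => (hint i j).const_mul _).trans ?_
  refine Finset.sum_congr rfl fun i _ => ?_
  refine (integral_finsetSum _ fun j _ => (hint i j).const_mul _).trans ?_
  refine Finset.sum_congr rfl fun j _ => ?_
  rw [integral_const_mul, hFi]
  simp only [Pi.sub_apply]
  ring

end CondMean

section Star

variable {d : ℕ} [NeZero d]

/-- The conditional law of the `j`-th coordinate given the root coordinate in `starMeasurePi`. -/
noncomputable def starFactor (κ : Fin d → Kernel ℝ ℝ) (j : Fin d) : Kernel ℝ ℝ :=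
  if j = 0 then Kernel.id else κ j

instance (κ : Fin d → Kernel ℝ ℝ) [∀ j, IsMarkovKernel (κ j)] (j : Fin d) :
    IsMarkovKernel (starFactor κ j) := by
  unfold starFactor
  split_ifs <;> infer_instance

lemma starMeasurePi_eq_comp (μ₁ : Measure ℝ) (κ : Fin d → Kernel ℝ ℝ)
    [∀ j, IsMarkovKernel (κ j)] :
    starMeasurePi μ₁ κ = piKernel (starFactor κ) ∘ₘ μ₁ := by
  unfold starMeasurePi
  congr 1
  funext x
  rw [piKernel_apply]
  congr 1
  funext j
  unfold starFactor
  split_ifs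
  · exact (Kernel.id_apply x).symm
  · rfl

lemma starMeasurePi_univ_pi (μ₁ : Measure ℝ) (κ : Fin d → Kernel ℝ ℝ)
    [∀ j, IsMarkovKernel (κ j)] {t : Fin d → Set ℝ} (ht : ∀ j, MeasurableSet (t j)) :
    starMeasurePi μ₁ κ (Set.univ.pi t) =
      ∫⁻ x, (t 0).indicator 1 x * ∏ j ∈ Finset.univ.erase 0, κ j x (t j) ∂μ₁ := by
  rw [starMeasurePi_eq_comp, Measure.bind_apply (MeasurableSet.univ_pi ht) (Kernel.aemeasurable _)]
  refine lintegral_congr fun x => ?_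
  rw [piKernel_apply, Measure.pi_pi, ← Finset.mul_prod_erase _ _ (Finset.mem_univ 0)]
  congr 1
  · simp [starFactor, Kernel.id_apply, Measure.dirac_apply' _ (ht 0)]
  · exact Finset.prod_congr rfl fun j hj => by simp [starFactor, Finset.ne_of_mem_erase hj]

instance (μ₁ : Measure ℝ) [IsProbabilityMeasure μ₁] (κ : Fin d → Kernel ℝ ℝ)
    [∀ j, IsMarkovKernel (κ j)] : IsProbabilityMeasure (starMeasurePi μ₁ κ) := by
  rw [starMeasurePi_eq_comp]
  infer_instance

lemma starMeasurePi_const (P : Fin d → Measure ℝ) [∀ j, IsProbabilityMeasure (P j)] :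
    starMeasurePi (P 0) (fun j => Kernel.const ℝ (P j)) = Measure.pi P := by
  refine (Measure.pi_eq fun t ht => ?_).symm
  rw [starMeasurePi_univ_pi _ _ ht]
  simp only [Kernel.const_apply]
  rw [lintegral_mul_const _ (measurable_one.indicator (ht 0)), lintegral_indicator_one (ht 0),
    Finset.mul_prod_erase _ (fun j => P j (t j)) (Finset.mem_univ 0)]

/-- The Gaussian kernel with mean `b x` and variance `v`. -/
noncomputable def gaussKernel {b : ℝ → ℝ} (hb : Measurable b) (v : NNReal) : Kernel ℝ ℝ where
  toFun x := gaussianReal (b x) v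
  measurable' := measurable_gaussianReal.comp (hb.prodMk measurable_const)

lemma gaussKernel_apply {b : ℝ → ℝ} (hb : Measurable b) (v : NNReal) (x : ℝ) :
    gaussKernel hb v x = gaussianReal (b x) v := rfl

instance {b : ℝ → ℝ} (hb : Measurable b) (v : NNReal) : IsMarkovKernel (gaussKernel hb v) :=
  ⟨fun x => by rw [gaussKernel_apply]; infer_instance⟩

/-- Density of the star-structured law whose root is `N(c, v 0)` and whose other coordinates are
`N(b j x, v j)` given the root value `x`. -/
noncomputable def starDensity (c : ℝ) (b : Fin d → ℝ → ℝ) (v : Fin d → NNReal)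
    (z : Fin d → ℝ) : ℝ :=
  ∏ j, gaussianPDFReal (if j = 0 then c else b j (z 0)) (v j) (z j)

variable {c : ℝ} {b : Fin d → ℝ → ℝ} {v : Fin d → NNReal}

lemma measurable_starDensity (hb : ∀ j, Measurable (b j)) : Measurable (starDensity c b v) := by
  refine Finset.measurable_prod _ fun j _ => ?_
  have : Measurable fun z : Fin d → ℝ => if j = 0 then c else b j (z 0) := by
    split_ifs
    · exact measurable_const
    · exact (hb j).comp (measurable_pi_apply 0)
  exact measurable_uncurry_gaussianPDFReal.comp
    (this.prodMk (measurable_const.prodMk (measurable_pi_apply j)))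

lemma starDensity_pos (hv : ∀ j, v j ≠ 0) (z : Fin d → ℝ) : 0 < starDensity c b v z :=
  Finset.prod_pos fun j _ => gaussianPDFReal_pos _ _ _ (hv j)

lemma lintegral_fin_succ {n : ℕ} {F : (Fin (n + 1) → ℝ) → ℝ≥0∞} (hF : Measurable F) :
    ∫⁻ z, F z = ∫⁻ x : ℝ, ∫⁻ y : Fin n → ℝ, F (Fin.cons x y : Fin (n + 1) → ℝ) := by
  have e := (volume_preserving_piFinSuccAbove (fun _ : Fin (n + 1) => ℝ) 0).symm
  have hFe : Measurable fun a => F ((MeasurableEquiv.piFinSuccAbove (fun _ => ℝ) 0).symm a) :=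
    hF.comp e.measurable
  rw [← e.lintegral_comp hF, Measure.volume_eq_prod, lintegral_prod _ hFe.aemeasurable]
  refine lintegral_congr fun x => lintegral_congr fun y => ?_
  congr 1
  simp [MeasurableEquiv.piFinSuccAbove_symm_apply, Fin.insertNthEquiv, Fin.insertNth_zero']

lemma lintegral_fin_nat_prod {n : ℕ} {f : Fin n → ℝ → ℝ≥0∞} (hf : ∀ i, Measurable (f i)) :
    ∫⁻ y : Fin n → ℝ, ∏ i, f i (y i) = ∏ i, ∫⁻ x, f i x := by
  induction n with
  | zero => simp [volume_pi]
  | succ n ih =>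
    have hm : Measurable fun y : Fin (n + 1) → ℝ => ∏ i, f i (y i) :=
      Finset.measurable_prod _ fun i _ => (hf i).comp (measurable_pi_apply i)
    rw [lintegral_fin_succ hm]
    simp only [Fin.prod_univ_succ, Fin.cons_zero, Fin.cons_succ]
    rw [← ih fun i => hf i.succ, ← lintegral_mul_const _ (hf 0)]
    exact lintegral_congr fun x => lintegral_const_mul _
      (Finset.measurable_prod _ fun i _ => (hf i.succ).comp (measurable_pi_apply i))

lemma starMeasurePi_gaussKernel (hb : ∀ j, Measurable (b j)) (hv : ∀ j, v j ≠ 0) :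
    starMeasurePi (gaussianReal c (v 0)) (fun j => gaussKernel (hb j) (v j)) =
      volume.withDensity fun z => ENNReal.ofReal (starDensity c b v z) := by
  obtain _ | n := d
  · exact absurd rfl (NeZero.ne 0)
  obtain rfl : ‹NeZero (n + 1)› = ⟨n.succ_ne_zero⟩ := Subsingleton.elim _ _
  have hbox : ∀ t : Fin (n + 1) → Set ℝ, (∀ j, MeasurableSet (t j)) →
      starMeasurePi (gaussianReal c (v 0)) (fun j => gaussKernel (hb j) (v j)) (Set.univ.pi t) =
      (volume.withDensity fun z => ENNReal.ofReal (starDensity c b v z)) (Set.univ.pi t) := by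
    intro t ht
    set G : Fin n → ℝ → ℝ → ℝ≥0∞ := fun j x =>
      (t j.succ).indicator (gaussianPDF (b j.succ x) (v j.succ)) with hG
    have hind : ∀ z : Fin (n + 1) → ℝ,
        (Set.univ.pi t).indicator (fun z => ENNReal.ofReal (starDensity c b v z)) z =
        (t 0).indicator (gaussianPDF c (v 0)) (z 0) * ∏ j : Fin n, G j (z 0) (z j.succ) := by
      intro z
      by_cases hz : ∀ j, z j ∈ t j
      · rw [Set.indicator_of_mem (by simpa using hz), Set.indicator_of_mem (hz 0), starDensity,
          ENNReal.ofReal_prod_of_nonneg fun j _ => gaussianPDFReal_nonneg _ _ _,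
          Fin.prod_univ_succ]
        congr 1
        refine Finset.prod_congr rfl fun j _ => ?_
        simp [hG, Set.indicator_of_mem (hz j.succ), gaussianPDF]
      · rw [Set.indicator_of_notMem (by simpa using hz)]
        obtain ⟨j, hj⟩ := not_forall.1 hz
        obtain rfl | ⟨i, rfl⟩ := Fin.eq_zero_or_eq_succ j
        · rw [Set.indicator_of_notMem hj, zero_mul]
        · rw [Finset.prod_eq_zero (Finset.mem_univ i), mul_zero]
          simp only [hG, Set.indicator_of_notMem hj]
    have hm : Measurable
        ((Set.univ.pi t).indicator fun z => ENNReal.ofReal (starDensity c b v z)) :=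
      (measurable_starDensity hb).ennreal_ofReal.indicator (MeasurableSet.univ_pi ht)
    have hGm : ∀ x i, Measurable (G i x) := fun x i =>
      (measurable_gaussianPDF _ _).indicator (ht i.succ)
    have hκm : Measurable fun x => ∏ j : Fin n, gaussianReal (b j.succ x) (v j.succ) (t j.succ) :=
      Finset.measurable_prod _ fun j _ => (gaussKernel (hb j.succ) (v j.succ)).measurable_coe
        (ht j.succ)
    rw [withDensity_apply _ (MeasurableSet.univ_pi ht), ← lintegral_indicator
      (MeasurableSet.univ_pi ht), lintegral_fin_succ hm, starMeasurePi_univ_pi _ _ ht,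
      gaussianReal_of_var_ne_zero _ (hv 0)]
    have hprod (x : ℝ) : ∏ j ∈ Finset.univ.erase (0 : Fin (n + 1)),
        gaussKernel (hb j) (v j) x (t j) =
        ∏ j : Fin n, gaussianReal (b j.succ x) (v j.succ) (t j.succ) := by
      have himg : Finset.univ.erase (0 : Fin (n + 1)) = Finset.univ.image Fin.succ := by
        ext j
        simp
      rw [himg, Finset.prod_image (Fin.succ_injective n).injOn]
      rfl
    simp_rw [hprod]
    have hm1 : Measurable fun x => (t 0).indicator 1 x *
        ∏ j : Fin n, gaussianReal (b j.succ x) (v j.succ) (t j.succ) :=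
      (measurable_one.indicator (ht 0)).mul hκm
    rw [lintegral_withDensity_eq_lintegral_mul _ (measurable_gaussianPDF _ _) hm1]
    refine lintegral_congr fun x => ?_
    simp only [hind, Fin.cons_zero, Fin.cons_succ]
    have hGp : Measurable fun y : Fin n → ℝ => ∏ i, G i x (y i) :=
      Finset.measurable_prod _ fun i _ => (hGm x i).comp (measurable_pi_apply i)
    rw [lintegral_const_mul _ hGp, lintegral_fin_nat_prod (hGm x)]
    have hGi : ∀ i, ∫⁻ y, G i x y = gaussianReal (b i.succ x) (v i.succ) (t i.succ) := fun i => by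
      rw [hG, lintegral_indicator (ht i.succ), gaussianReal_apply _ (hv i.succ)]
    simp_rw [hGi]
    by_cases hx : x ∈ t 0 <;> simp [hx]
  refine ext_of_generate_finite _ generateFrom_pi.symm isPiSystem_pi ?_ ?_
  · rintro _ ⟨t, ht, rfl⟩
    exact hbox t fun j => ht j (Set.mem_univ j)
  · simpa using hbox (fun _ => Set.univ) fun _ => MeasurableSet.univ

end Star

section GaussianTarget

variable {d : ℕ} {m : Fin d → ℝ} {S : Matrix (Fin d) (Fin d) ℝ}

lemma measurable_quadForm (Q : Matrix (Fin d) (Fin d) ℝ) (m : Fin d → ℝ) :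
    Measurable fun z : Fin d → ℝ => quadForm Q (z - m) := by
  unfold quadForm
  fun_prop

lemma integrable_quadForm {ν : Measure (Fin d → ℝ)} [IsFiniteMeasure ν]
    (h : ∀ j, MemLp (fun z : Fin d → ℝ => z j) 2 ν) (Q : Matrix (Fin d) (Fin d) ℝ)
    (m : Fin d → ℝ) : Integrable (fun z => quadForm Q (z - m)) ν := by
  have hL (j : Fin d) : MemLp (fun z : Fin d → ℝ => z j - m j) 2 ν := (h j).sub (memLp_const _)
  refine integrable_finsetSum _ fun i _ => integrable_finsetSum _ fun j _ => ?_
  refine (((hL i).integrable_mul (hL j)).const_mul (Q i j)).congr (.of_forall fun z => ?_)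
  simp only [Pi.mul_apply, Pi.sub_apply]
  ring

lemma gaussDensity_eq (z : Fin d → ℝ) :
    gaussDensity m S z =
      (√((2 * Real.pi) ^ d * S.det))⁻¹ * Real.exp (-quadForm S⁻¹ (z - m) / 2) := rfl

lemma gaussDensity_pos (hS : S.PosDef) (z : Fin d → ℝ) : 0 < gaussDensity m S z := by
  have := hS.det_pos
  rw [gaussDensity_eq]
  positivity

lemma measurable_gaussDensity : Measurable (gaussDensity m S) :=
  ((measurable_quadForm S⁻¹ m).neg.div_const 2).exp.const_mul _

lemma sum_sq_div_le_quadForm_inv (hS : S.PosDef) (x : Fin d → ℝ) :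
    ∑ j, x j ^ 2 / S j j ≤ d * quadForm S⁻¹ x := by
  calc ∑ j, x j ^ 2 / S j j ≤ ∑ _j : Fin d, quadForm S⁻¹ x := Finset.sum_le_sum fun j _ => by
        rw [div_le_iff₀ hS.diag_pos, mul_comm]
        exact sq_le_mul_quadForm_inv hS x j
    _ = _ := by simp

lemma lintegral_exp_neg_quadForm_lt_top (hS : S.PosDef) (m : Fin d → ℝ) {t : ℝ} (ht : 0 < t) :
    ∫⁻ z, ENNReal.ofReal (Real.exp (-(t * quadForm S⁻¹ (z - m)))) < ⊤ := by
  set f : Fin d → ℝ → ℝ≥0∞ := fun j x =>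
    ENNReal.ofReal (Real.exp (-(t / (d * S j j)) * (x - m j) ^ 2)) with hf
  have hfin : ∏ j, ∫⁻ x, f j x < ⊤ := ENNReal.prod_lt_top fun j _ => by
    have hd : (0 : ℝ) < d := Nat.cast_pos.2 j.pos
    have hj := hS.diag_pos (i := j)
    exact ((integrable_exp_neg_mul_sq (show 0 < t / (d * S j j) by positivity)).comp_sub_right
      (m j)).lintegral_lt_top
  rw [← lintegral_fin_nat_prod fun j => by fun_prop] at hfin
  refine lt_of_le_of_lt (lintegral_mono fun z => ?_) hfin
  rw [hf, ← ENNReal.ofReal_prod_of_nonneg fun j _ => (Real.exp_pos _).le, ← Real.exp_sum]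
  refine ENNReal.ofReal_le_ofReal (Real.exp_le_exp.2 ?_)
  rcases Nat.eq_zero_or_pos d with rfl | hd
  · simp [quadForm]
  have hd' : (0 : ℝ) < d := Nat.cast_pos.2 hd
  have h := mul_le_mul_of_nonneg_left (sum_sq_div_le_quadForm_inv hS (z - m)) (div_pos ht hd').le
  have hs : ∑ j, -(t / (d * S j j)) * (z j - m j) ^ 2 =
      -(t / d * ∑ j, (z - m) j ^ 2 / S j j) := by
    rw [Finset.mul_sum, ← Finset.sum_neg_distrib]
    refine Finset.sum_congr rfl fun j _ => ?_
    rw [Pi.sub_apply, ← div_div]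
    ring
  rw [hs]
  have : t / d * (d * quadForm S⁻¹ (z - m)) = t * quadForm S⁻¹ (z - m) := by field_simp
  linarith

instance : SigmaFinite (gaussPi m S) := SigmaFinite.withDensity_ofReal _

/-- Finite divergence from a Gaussian forces finite second moments. -/
lemma memLp_eval_of_KL_ne_top (hS : S.PosDef) {μ : Measure (Fin d → ℝ)} [IsProbabilityMeasure μ]
    (hKL : KL μ (gaussPi m S) ≠ ⊤) (j : Fin d) : MemLp (fun z : Fin d → ℝ => z j) 2 μ := by
  have hq : Integrable (fun z => 1 / 4 * quadForm S⁻¹ (z - m)) μ := by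
    refine integrable_of_KL_ne_top hKL ((measurable_quadForm _ _).const_mul _)
      (fun z => mul_nonneg (by norm_num) (quadForm_nonneg hS.inv _)) ?_
    have hm : Measurable fun z => ENNReal.ofReal (Real.exp (1 / 4 * quadForm S⁻¹ (z - m))) :=
      ((measurable_quadForm _ _).const_mul _).exp.ennreal_ofReal
    rw [gaussPi, lintegral_withDensity_eq_lintegral_mul _
      measurable_gaussDensity.ennreal_ofReal hm]
    have hprod (z : Fin d → ℝ) : ((fun z => ENNReal.ofReal (gaussDensity m S z)) *
          fun z => ENNReal.ofReal (Real.exp (1 / 4 * quadForm S⁻¹ (z - m)))) z =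
        ENNReal.ofReal (√((2 * Real.pi) ^ d * S.det))⁻¹ *
          ENNReal.ofReal (Real.exp (-(1 / 4 * quadForm S⁻¹ (z - m)))) := by
      rw [Pi.mul_apply, ← ENNReal.ofReal_mul (gaussDensity_pos hS z).le,
        ← ENNReal.ofReal_mul (by positivity), gaussDensity_eq, mul_assoc, ← Real.exp_add]
      ring_nf
    simp_rw [hprod]
    rw [lintegral_const_mul' _ _ ENNReal.ofReal_ne_top]
    exact ENNReal.mul_ne_top ENNReal.ofReal_ne_top
      (lintegral_exp_neg_quadForm_lt_top hS m (by norm_num)).ne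
  have hm : Measurable fun z : Fin d → ℝ => z j - m j := by fun_prop
  have hL : MemLp (fun z : Fin d → ℝ => z j - m j) 2 μ := by
    rw [memLp_two_iff_integrable_sq hm.aestronglyMeasurable]
    refine (hq.const_mul (4 * S j j)).mono' (hm.pow_const 2).aestronglyMeasurable
      (.of_forall fun z => ?_)
    rw [Real.norm_of_nonneg (sq_nonneg _)]
    have := sq_le_mul_quadForm_inv hS (z - m) j
    rw [Pi.sub_apply] at this
    linarith
  exact (hL.add (memLp_const (m j))).ae_eq (.of_forall fun z => sub_add_cancel (z j) (m j))

variable [NeZero d]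

/-- Variances of the optimal star-structured approximation with root variance `a`. -/
noncomputable def starVar (S : Matrix (Fin d) (Fin d) ℝ) (a : ℝ) (j : Fin d) : NNReal :=
  if j = 0 then a.toNNReal else (S⁻¹ j j)⁻¹.toNNReal

lemma coe_starVar_zero {a : ℝ} (ha : 0 < a) : (starVar S a 0 : ℝ) = a := by
  simp [starVar, ha.le]

lemma coe_starVar (hS : S.PosDef) (a : ℝ) {j : Fin d} (hj : j ≠ 0) :
    (starVar S a j : ℝ) = (S⁻¹ j j)⁻¹ := by
  rw [starVar, if_neg hj, Real.coe_toNNReal _ (inv_pos.2 hS.inv.diag_pos).le]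

lemma starVar_ne_zero (hS : S.PosDef) {a : ℝ} (ha : 0 < a) (j : Fin d) : starVar S a j ≠ 0 := by
  rw [← NNReal.coe_ne_zero]
  by_cases hj : j = 0
  · rw [hj, coe_starVar_zero ha]
    exact ha.ne'
  · rw [coe_starVar hS a hj]
    exact (inv_pos.2 hS.inv.diag_pos).ne'

/-- Divergence of the optimal star-structured approximation with root variance `a`. -/
noncomputable def starValue (S : Matrix (Fin d) (Fin d) ℝ) (a : ℝ) : ℝ :=
  (Real.log S.det - Real.log a + ∑ j ∈ Finset.univ.erase 0, Real.log (S⁻¹ j j)) / 2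

lemma starValue_diag_nonneg (hS : S.PosDef) : 0 ≤ starValue S (S 0 0) := by
  have h0 := hS.diag_pos (i := (0 : Fin d))
  have h := Real.log_le_log (mul_pos h0 hS.inv.det_pos) (mul_det_inv_le_prod_diag hS 0)
  rw [Real.log_prod fun i _ => hS.inv.diag_pos.ne', Real.log_mul h0.ne' hS.inv.det_pos.ne',
    Matrix.det_nonsing_inv, Ring.inverse_eq_inv', Real.log_inv] at h
  unfold starValue
  linarith

lemma log_gaussianPDFReal {v : NNReal} (hv : v ≠ 0) (c x : ℝ) :
    Real.log (gaussianPDFReal c v x) =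
      -(Real.log (2 * Real.pi) + Real.log v) / 2 - (x - c) ^ 2 / v / 2 := by
  have hv' : (0 : ℝ) < v := NNReal.coe_pos.2 (pos_iff_ne_zero.2 hv)
  rw [gaussianPDFReal, Real.log_mul (by positivity) (Real.exp_pos _).ne', Real.log_exp,
    Real.log_inv, Real.log_sqrt (by positivity), Real.log_mul (by positivity) hv'.ne']
  field_simp
  ring

lemma log_starDensity_div_gaussDensity (hS : S.PosDef) {a : ℝ} (ha : 0 < a) (c : ℝ)
    (b : Fin d → ℝ → ℝ) (z : Fin d → ℝ) :
    Real.log (starDensity c b (starVar S a) z / gaussDensity m S z) =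
      starValue S a + (quadForm S⁻¹ (z - m) - (z 0 - c) ^ 2 / a -
        ∑ j ∈ Finset.univ.erase 0, S⁻¹ j j * (z j - b j (z 0)) ^ 2) / 2 := by
  have hv := starVar_ne_zero hS ha
  have hdet := hS.det_pos
  have h2π : (0 : ℝ) < 2 * Real.pi := by positivity
  rw [Real.log_div (starDensity_pos hv z).ne' (gaussDensity_pos hS z).ne', gaussDensity_eq,
    Real.log_mul (by positivity) (Real.exp_pos _).ne', Real.log_exp, Real.log_inv,
    Real.log_sqrt (by positivity), Real.log_mul (by positivity) hdet.ne', Real.log_pow,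
    starDensity, Real.log_prod fun j _ => (gaussianPDFReal_pos _ _ _ (hv j)).ne',
    ← Finset.add_sum_erase _ _ (Finset.mem_univ (0 : Fin d)), log_gaussianPDFReal (hv 0),
    coe_starVar_zero ha, if_pos rfl, Finset.sum_congr rfl (g := fun j =>
      -Real.log (2 * Real.pi) / 2 + Real.log (S⁻¹ j j) / 2 -
        S⁻¹ j j * (z j - b j (z 0)) ^ 2 / 2)]
  · simp only [Finset.sum_sub_distrib, Finset.sum_add_distrib, ← Finset.sum_div,
      Finset.sum_const, Finset.card_erase_of_mem (Finset.mem_univ (0 : Fin d)), Finset.card_univ,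
      Fintype.card_fin, nsmul_eq_mul, Nat.cast_pred (Nat.pos_of_neZero d), starValue]
    ring
  · intro j hj
    have hj := Finset.ne_of_mem_erase hj
    rw [log_gaussianPDFReal (hv j), coe_starVar hS a hj, if_neg hj, Real.log_inv, div_inv_eq_mul]
    ring

section Expectation

variable {μ₁ : Measure ℝ} {κ : Fin d → Kernel ℝ ℝ} {b : Fin d → ℝ → ℝ}

lemma integral_starFactor (hκ : ∀ j x, ∫ y, y ∂κ j x = b j x) (j : Fin d) (x : ℝ) :
    ∫ y, y ∂starFactor κ j x = if j = 0 then x else b j x := by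
  unfold starFactor
  split_ifs
  · simp [Kernel.id_apply]
  · exact hκ j x

variable [∀ j, IsMarkovKernel (κ j)]

lemma measurePreserving_eval_zero_star :
    MeasurePreserving (fun z : Fin d → ℝ => z 0) (starMeasurePi μ₁ κ) μ₁ := by
  refine ⟨measurable_pi_apply 0, ?_⟩
  rw [starMeasurePi_eq_comp, map_eval_comp_piKernel]
  simp [starFactor, Measure.id_comp]

lemma memLp_starFactor (hL : ∀ j, MemLp (fun z : Fin d → ℝ => z j) 2 (starMeasurePi μ₁ κ))
    (j : Fin d) : MemLp id 2 (starFactor κ j ∘ₘ μ₁) := by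
  have hm : Measurable fun z : Fin d → ℝ => z j := measurable_pi_apply j
  rw [← map_eval_comp_piKernel, ← starMeasurePi_eq_comp]
  exact (memLp_map_measure_iff aestronglyMeasurable_id hm.aemeasurable).2 (hL j)

lemma ae_eval_zero_eq (x : ℝ) : ∀ᵐ z ∂piKernel (starFactor κ) x, z 0 = x := by
  rw [piKernel_apply]
  refine (measurePreserving_eval (fun j => starFactor κ j x) 0).quasiMeasurePreserving.ae
    (p := fun y => y = x) ?_
  simp [starFactor, Kernel.id_apply, ae_dirac_eq]

variable [IsProbabilityMeasure μ₁]

lemma integrable_starQuad (hκ : ∀ j x, ∫ y, y ∂κ j x = b j x)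
    (hL : ∀ j, MemLp (fun z : Fin d → ℝ => z j) 2 (starMeasurePi μ₁ κ))
    (Q : Matrix (Fin d) (Fin d) ℝ) (m : Fin d → ℝ) (c a : ℝ) :
    Integrable (fun z => quadForm Q (z - m) - (z 0 - c) ^ 2 / a -
      ∑ j ∈ Finset.univ.erase 0, Q j j * (z j - b j (z 0)) ^ 2) (starMeasurePi μ₁ κ) := by
  refine ((integrable_quadForm hL Q m).sub
    (((hL 0).sub (memLp_const c)).integrable_sq.div_const a)).sub
    (integrable_finsetSum _ fun j hj => Integrable.const_mul ?_ _)
  have hb := memLp_integral_of_memLp_comp (memLp_starFactor hL j)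
  simp only [integral_starFactor hκ, if_neg (Finset.ne_of_mem_erase hj)] at hb
  exact ((hL j).sub (hb.comp_measurePreserving measurePreserving_eval_zero_star)).integrable_sq

lemma integral_starQuad (hκ : ∀ j x, ∫ y, y ∂κ j x = b j x)
    (hL : ∀ j, MemLp (fun z : Fin d → ℝ => z j) 2 (starMeasurePi μ₁ κ))
    (Q : Matrix (Fin d) (Fin d) ℝ) (m : Fin d → ℝ) (c a : ℝ) :
    ∫ z, (quadForm Q (z - m) - (z 0 - c) ^ 2 / a -
        ∑ j ∈ Finset.univ.erase 0, Q j j * (z j - b j (z 0)) ^ 2) ∂starMeasurePi μ₁ κ =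
      ∫ x, (quadForm Q ((fun j => if j = 0 then x else b j x) - m) - (x - c) ^ 2 / a) ∂μ₁ := by
  have hint := integrable_starQuad hκ hL Q m c a
  rw [starMeasurePi_eq_comp] at hint ⊢
  rw [integral_comp_measure hint]
  have hae : ∀ᵐ x ∂μ₁, ∀ j, MemLp id 2 (starFactor κ j x) :=
    ae_all_iff.2 fun j => ae_memLp_of_memLp_comp (memLp_starFactor hL j)
  refine integral_congr_ae ?_
  filter_upwards [hae] with x hx
  have hc : ∀ᵐ z ∂piKernel (starFactor κ) x, quadForm Q (z - m) - (z 0 - c) ^ 2 / a -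
        ∑ j ∈ Finset.univ.erase 0, Q j j * (z j - b j (z 0)) ^ 2 =
      (quadForm Q (z - m) - ∑ j, Q j j * (z j - ∫ y, y ∂starFactor κ j x) ^ 2) -
        (x - c) ^ 2 / a := by
    filter_upwards [ae_eval_zero_eq x] with z hz
    rw [← Finset.add_sum_erase _ _ (Finset.mem_univ (0 : Fin d)), integral_starFactor hκ,
      if_pos rfl, hz, Finset.sum_congr rfl (g := fun j =>
        Q j j * (z j - ∫ y, y ∂starFactor κ j x) ^ 2) fun j hj => by
          rw [integral_starFactor hκ, if_neg (Finset.ne_of_mem_erase hj)]]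
    ring
  rw [integral_congr_ae hc, piKernel_apply, integral_sub _ (integrable_const _),
    integral_quadForm_sub hx]
  · simp [integral_starFactor hκ]
  · exact (integrable_quadForm (fun j => memLp_eval (hx j)) Q m).sub
      (integrable_finsetSum _ fun j _ =>
        (((memLp_eval (hx j)).sub (memLp_const _)).integrable_sq.const_mul _))

lemma integrable_log_starDensity_div (hS : S.PosDef) {a : ℝ} (ha : 0 < a) (c : ℝ)
    (hκ : ∀ j x, ∫ y, y ∂κ j x = b j x)
    (hL : ∀ j, MemLp (fun z : Fin d → ℝ => z j) 2 (starMeasurePi μ₁ κ)) :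
    Integrable (fun z => Real.log (starDensity c b (starVar S a) z / gaussDensity m S z))
      (starMeasurePi μ₁ κ) := by
  simp_rw [log_starDensity_div_gaussDensity hS ha]
  exact (integrable_const _).add ((integrable_starQuad hκ hL S⁻¹ m c a).div_const 2)

lemma integral_log_starDensity_div (hS : S.PosDef) {a : ℝ} (ha : 0 < a) (c : ℝ)
    (hκ : ∀ j x, ∫ y, y ∂κ j x = b j x)
    (hL : ∀ j, MemLp (fun z : Fin d → ℝ => z j) 2 (starMeasurePi μ₁ κ)) :
    ∫ z, Real.log (starDensity c b (starVar S a) z / gaussDensity m S z) ∂starMeasurePi μ₁ κ =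
      starValue S a + (∫ x, (quadForm S⁻¹ ((fun j => if j = 0 then x else b j x) - m) -
        (x - c) ^ 2 / a) ∂μ₁) / 2 := by
  simp_rw [log_starDensity_div_gaussDensity hS ha]
  rw [integral_add (integrable_const _) ((integrable_starQuad hκ hL S⁻¹ m c a).div_const 2),
    integral_div, integral_starQuad hκ hL]
  simp

/-- Lower bound for the divergence of a star-structured measure. -/
lemma le_KL_starMeasurePi (hS : S.PosDef) {a : ℝ} (ha : 0 < a) (c : ℝ)
    (hκ : ∀ j x, ∫ y, y ∂κ j x = b j x)
    (hnonneg : (∀ j, MemLp (fun z : Fin d → ℝ => z j) 2 (starMeasurePi μ₁ κ)) →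
      0 ≤ ∫ x, (quadForm S⁻¹ ((fun j => if j = 0 then x else b j x) - m) -
        (x - c) ^ 2 / a) ∂μ₁) :
    ENNReal.ofReal (starValue S a) ≤ KL (starMeasurePi μ₁ κ) (gaussPi m S) := by
  by_cases hKL : KL (starMeasurePi μ₁ κ) (gaussPi m S) = ⊤
  · rw [hKL]
    exact le_top
  have hL := memLp_eval_of_KL_ne_top hS hKL
  have hb (j : Fin d) : Measurable (b j) := by
    rw [← funext (hκ j)]
    exact (stronglyMeasurable_id.integral_kernel (κ := κ j)).measurable
  have hv := starVar_ne_zero hS ha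
  have hp1 : ∫⁻ z, ENNReal.ofReal (starDensity c b (starVar S a) z) ≤ 1 := by
    rw [← setLIntegral_univ, ← withDensity_apply _ MeasurableSet.univ,
      ← starMeasurePi_gaussKernel hb hv, measure_univ]
  refine le_trans (ENNReal.ofReal_le_ofReal ?_)
    (ofReal_integral_log_div_le_KL (measurable_starDensity hb) measurable_gaussDensity
      (starDensity_pos hv) (gaussDensity_pos hS) hp1 hKL
      (integrable_log_starDensity_div hS ha c hκ hL))
  rw [integral_log_starDensity_div hS ha c hκ hL]
  linarith [hnonneg hL]

lemma memLp_eval_starMeasurePi_gaussKernel {v : Fin d → NNReal} (c : ℝ)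
    (hb : ∀ j, Measurable (b j)) (hbL : ∀ j, MemLp (b j) 2 (gaussianReal c (v 0))) (j : Fin d) :
    MemLp (fun z : Fin d → ℝ => z j) 2
      (starMeasurePi (gaussianReal c (v 0)) fun j => gaussKernel (hb j) (v j)) := by
  by_cases hj : j = 0
  · subst hj
    exact (memLp_id_gaussianReal' 2 (by simp)).comp_measurePreserving
      measurePreserving_eval_zero_star
  have hcoord : MemLp id 2 (gaussKernel (hb j) (v j) ∘ₘ gaussianReal c (v 0)) := by
    rw [memLp_two_iff_integrable_sq aestronglyMeasurable_id, Measure.integrable_comp_iff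
      (measurable_id.pow_const 2).aestronglyMeasurable]
    have hG (x : ℝ) : MemLp id 2 (gaussKernel (hb j) (v j) x) := by
      rw [gaussKernel_apply]
      exact memLp_id_gaussianReal' 2 (by simp)
    refine ⟨.of_forall fun x => (hG x).integrable_sq, ?_⟩
    refine ((hbL j).integrable_sq.add (integrable_const (v j : ℝ))).congr (.of_forall fun x => ?_)
    have := variance_eq_sub (hG x)
    rw [gaussKernel_apply, variance_id_gaussianReal] at this
    simp only [id, integral_id_gaussianReal, Pi.pow_apply] at this
    simp only [Pi.add_apply, gaussKernel_apply, id, Real.norm_eq_abs, abs_sq]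
    linarith
  have hK : starFactor (fun j => gaussKernel (hb j) (v j)) j = gaussKernel (hb j) (v j) := if_neg hj
  have hm : Measurable fun z : Fin d → ℝ => z j := measurable_pi_apply j
  rw [← hK, ← map_eval_comp_piKernel, ← starMeasurePi_eq_comp] at hcoord
  exact (memLp_map_measure_iff aestronglyMeasurable_id hm.aemeasurable).1 hcoord

/-- The Gaussian star-structured measure attains the lower bound. -/
lemma KL_starMeasurePi_gaussKernel (hS : S.PosDef) {a : ℝ} (ha : 0 < a) (c : ℝ)
    (hb : ∀ j, Measurable (b j))
    (hbL : ∀ j, MemLp (b j) 2 (gaussianReal c (starVar S a 0)))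
    (hq : ∀ x, quadForm S⁻¹ ((fun j => if j = 0 then x else b j x) - m) = (x - c) ^ 2 / a) :
    KL (starMeasurePi (gaussianReal c (starVar S a 0)) fun j => gaussKernel (hb j) (starVar S a j))
      (gaussPi m S) = ENNReal.ofReal (starValue S a) := by
  have hv := starVar_ne_zero hS ha
  have hκ (j : Fin d) (x : ℝ) : ∫ y, y ∂gaussKernel (hb j) (starVar S a j) x = b j x := by
    rw [gaussKernel_apply, integral_id_gaussianReal]
  have hL := memLp_eval_starMeasurePi_gaussKernel (v := starVar S a) c hb hbL
  have hint := integrable_log_starDensity_div (m := m) hS ha c hκ hL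
  have hval := integral_log_starDensity_div (m := m) hS ha c hκ hL
  simp only [hq, sub_self, integral_zero, zero_div, add_zero] at hval
  rw [starMeasurePi_gaussKernel hb hv] at hint hval ⊢
  rw [gaussPi, KL_withDensity (measurable_starDensity hb) measurable_gaussDensity
    (starDensity_pos hv) (gaussDensity_pos hS) hint, hval]

end Expectation

lemma iInf_KL_isStarPi (hS : S.PosDef) :
    ⨅ (μ : Measure (Fin d → ℝ)) (_ : IsStarPi μ), KL μ (gaussPi m S) =
      ENNReal.ofReal (starValue S (S 0 0)) := by
  have ha := hS.diag_pos (i := (0 : Fin d))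
  refine le_antisymm ?_ (le_iInf₂ ?_)
  · set b : Fin d → ℝ → ℝ := fun j x => m j + S j 0 * ((x - m 0) / S 0 0) with hbdef
    have hb (j : Fin d) : Measurable (b j) := by fun_prop
    have hbL (j : Fin d) : MemLp (b j) 2 (gaussianReal (m 0) (starVar S (S 0 0) 0)) :=
      (memLp_const (m j)).add ((((memLp_id_gaussianReal' 2 (by simp)).sub
        (memLp_const (m 0))).mul_const (S 0 0)⁻¹).const_mul (S j 0))
    rw [← KL_starMeasurePi_gaussKernel (m := m) hS ha (m 0) hb hbL fun x => ?_]
    · exact iInf₂_le _ ⟨inferInstance, _, _, inferInstance, fun j => inferInstance, rfl⟩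
    · have : ((fun j => if j = 0 then x else b j x) - m) =
          fun j => S j 0 * ((x - m 0) / S 0 0) := by
        ext j
        by_cases hj : j = 0
        · subst hj
          simp only [Pi.sub_apply, if_true]
          field_simp
        · simp [hj, hbdef]
      rw [this, quadForm_inv_smul_col hS]
      field_simp
  · rintro _ ⟨-, μ₁, κ, hμ₁, hκ, rfl⟩
    refine le_KL_starMeasurePi hS ha (m 0) (fun j x => rfl) fun _ => integral_nonneg fun x => ?_
    have h := sq_le_mul_quadForm_inv hS
      ((fun j => if j = 0 then x else ∫ y, y ∂κ j x) - m) 0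
    simp only [Pi.sub_apply, if_true] at h
    rw [Pi.zero_apply, sub_nonneg, div_le_iff₀ ha, mul_comm]
    exact h

lemma iInf_KL_isProductProb (hS : S.PosDef) :
    ⨅ (μ : Measure (Fin d → ℝ)) (_ : IsProductProb μ), KL μ (gaussPi m S) =
      ENNReal.ofReal (starValue S (S⁻¹ 0 0)⁻¹) := by
  have hQ := hS.inv.diag_pos (i := (0 : Fin d))
  have ha := inv_pos.2 hQ
  have hsplit (e : Fin d → ℝ) (x : ℝ) : (fun j => if j = 0 then x else e j) - m =
      (e - m) + Pi.single 0 (x - e 0) := by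
    ext j
    by_cases hj : j = 0
    · subst hj
      simp
    · simp [hj]
  have hquad (e : Fin d → ℝ) (x : ℝ) :
      quadForm S⁻¹ ((fun j => if j = 0 then x else e j) - m) - (x - e 0) ^ 2 / (S⁻¹ 0 0)⁻¹ =
        quadForm S⁻¹ (e - m) + 2 * (S⁻¹.mulVec (e - m) 0) * (x - e 0) := by
    rw [hsplit, quadForm_add hS.inv.isSymm, quadForm_single, div_inv_eq_mul, single_dotProduct]
    ring
  refine le_antisymm ?_ (le_iInf₂ ?_)
  · rw [← KL_starMeasurePi_gaussKernel (m := m) (b := fun j _ => m j) hS ha (m 0)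
      (fun _ => measurable_const) (fun j => memLp_const (m j)) fun x => ?_]
    · refine iInf₂_le _ ⟨fun j => gaussianReal (m j) (starVar S (S⁻¹ 0 0)⁻¹ j),
        fun j => inferInstance, ?_⟩
      rw [← starMeasurePi_const]
      rfl
    · rw [← sub_eq_zero, hquad]
      simp [quadForm]
  · rintro _ ⟨P, hP, rfl⟩
    rw [← starMeasurePi_const]
    refine le_KL_starMeasurePi (b := fun j _ => ∫ y, y ∂P j) hS ha (∫ y, y ∂P 0)
      (fun j x => by rw [Kernel.const_apply]) fun hL => ?_
    have hid : Integrable id (P 0) := by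
      simpa [starFactor, Measure.id_comp] using (memLp_starFactor hL 0).integrable one_le_two
    have hsub : Integrable (fun x => x - ∫ y, y ∂P 0) (P 0) := hid.sub (integrable_const _)
    have hzero : ∫ x, (x - ∫ y, y ∂P 0) ∂P 0 = 0 := by
      rw [integral_sub (f := fun x => x) hid (integrable_const _)]
      simp
    simp_rw [hquad fun j => ∫ y, y ∂P j]
    rw [integral_add (integrable_const _) (hsub.const_mul _), integral_const_mul, hzero]
    simpa using quadForm_nonneg hS.inv _

end GaussianTarget

/-- **The improvement of SSVI over MFVI for a Gaussian target**:
`inf_{C_star} KL - inf_{P(ℝ)^{⊗d}} KL = -(1/2) log (σ₁₁ / (σ^{11})⁻¹) ≤ 0`. -/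
theorem stmt8 {d : ℕ} [NeZero d] (hd : 2 ≤ d)
    (m : Fin d → ℝ) (S : Matrix (Fin d) (Fin d) ℝ) (hS : S.PosDef)
    (π : Measure (Fin d → ℝ)) (hπ : π = gaussPi m S) :
    (⨅ (μ : Measure (Fin d → ℝ)) (_ : IsStarPi μ), KL μ π) ≤
      (⨅ (μ : Measure (Fin d → ℝ)) (_ : IsProductProb μ), KL μ π) ∧
    (⨅ (μ : Measure (Fin d → ℝ)) (_ : IsStarPi μ), KL μ π).toReal -
        (⨅ (μ : Measure (Fin d → ℝ)) (_ : IsProductProb μ), KL μ π).toReal =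
      -(1 / 2) * Real.log (S 0 0 / (S⁻¹ 0 0)⁻¹) := by
  subst hπ
  have ha := hS.diag_pos (i := (0 : Fin d))
  have hQ := hS.inv.diag_pos (i := (0 : Fin d))
  have h0 := starValue_diag_nonneg hS
  have hdiff : starValue S (S 0 0) - starValue S (S⁻¹ 0 0)⁻¹ =
      -(1 / 2) * Real.log (S 0 0 / (S⁻¹ 0 0)⁻¹) := by
    rw [Real.log_div ha.ne' (inv_pos.2 hQ).ne']
    unfold starValue
    ring
  have hlog : 0 ≤ Real.log (S 0 0 / (S⁻¹ 0 0)⁻¹) := by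
    rw [div_inv_eq_mul]
    exact Real.log_nonneg (one_le_mul_inv_diag hS 0)
  rw [iInf_KL_isStarPi hS, iInf_KL_isProductProb hS]
  have hle : starValue S (S 0 0) ≤ starValue S (S⁻¹ 0 0)⁻¹ := by linarith
  refine ⟨ENNReal.ofReal_le_ofReal hle, ?_⟩
  rw [ENNReal.toReal_ofReal h0, ENNReal.toReal_ofReal (h0.trans hle), hdiff]
end
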